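/- arXiv:2502.14723 — 11 statements merged into one kernel-verified Lean document; each statement's English description precedes it below -/
import Mathlib

section
/- Let L > 0 and let u, v : ℝ × ℝ → ℝ be smooth (C^∞) functions, L-periodic in the second (spatial) variable, solving the DSW system. Then for every t ∈ ℝ one has ∫₀ᴸ (u(t,x)² + v(t,x)²) dx = ∫₀ᴸ (u(0,x)² + v(0,x)²) dx. -/
open MeasureTheory Real

/-- If the `t`-derivative of a `C¹` function integrates to zero over `[a, b]` at every time, then the
integral of the function over `[a, b]` does not depend on time. -/
theorem intervalIntegral_eq_of_integral_deriv_eq_zero {F : ℝ × ℝ → ℝ} (hF : ContDiff ℝ 1 F)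
    {a b : ℝ} (h : ∀ t, ∫ x in a..b, deriv (fun s => F (s, x)) t = 0) (t₀ t₁ : ℝ) :
    ∫ x in a..b, F (t₁, x) = ∫ x in a..b, F (t₀, x) := by
  have hdiff : ∀ t x, HasDerivAt (fun s => F (s, x)) (fderiv ℝ F (t, x) (1, 0)) t := fun t x =>
    ((hF.differentiable one_ne_zero (t, x)).hasFDerivAt).comp_hasDerivAt t
      ((hasDerivAt_id t).prodMk (hasDerivAt_const t x))
  have hcont : Continuous fun p : ℝ × ℝ => fderiv ℝ F p (1, 0) :=
    (hF.continuous_fderiv one_ne_zero).clm_apply continuous_const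
  have hFc := hF.continuous
  have hft : ∀ x, ∫ t in t₀..t₁, fderiv ℝ F (t, x) (1, 0) = F (t₁, x) - F (t₀, x) := fun x =>
    intervalIntegral.integral_eq_sub_of_hasDerivAt (fun t _ => hdiff t x)
      (Continuous.intervalIntegrable (hcont.comp (by fun_prop)) _ _)
  have hint : ∀ t, IntervalIntegrable (fun x => F (t, x)) volume a b := fun t =>
    (hFc.comp (by fun_prop)).intervalIntegrable _ _
  rw [← sub_eq_zero, ← intervalIntegral.integral_sub (hint t₁) (hint t₀)]
  simp_rw [← hft]
  rw [intervalIntegral_intervalIntegral_swap]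
  · simp_rw [← (hdiff _ _).deriv, h, intervalIntegral.integral_zero]
  · exact ((hcont.comp continuous_swap).continuousOn.integrableOn_compact
      (isCompact_uIcc.prod isCompact_uIcc)).mono_set
      (Set.prod_mono Set.uIoc_subset_uIcc Set.uIoc_subset_uIcc)

/-- The right-hand side of the energy identity of the Drinfeld–Sokolov–Wilson system is the
derivative of a periodic flux, so it integrates to zero over a period. -/
theorem integral_dsw_energy_flux_eq_zero {L : ℝ} {f g : ℝ → ℝ}
    (hf : ContDiff ℝ 3 f) (hg : ContDiff ℝ 1 g)
    (hfper : Function.Periodic f L) (hgper : Function.Periodic g L) :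
    ∫ x in (0 : ℝ)..L, (f x * (deriv (fun y => f y * g y) x + iteratedDeriv 3 f x)
      + g x * (f x * deriv f x)) = 0 := by
  have hf1 : ContDiff ℝ 2 (deriv f) := ContDiff.deriv' hf
  have hf2 : ContDiff ℝ 1 (deriv (deriv f)) := ContDiff.deriv' hf1
  have hper {k : ℝ → ℝ} (hk : Function.Periodic k L) : Function.Periodic (deriv k) L := fun x => by
    rw [← deriv_comp_add_const, funext hk]
  have hf1per := hper hfper
  have hf2per := hper hf1per
  let G : ℝ → ℝ := fun x => f x ^ 2 * g x + f x * deriv (deriv f) x - deriv f x ^ 2 / 2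
  have hderiv : ∀ x, HasDerivAt G (f x * (deriv (fun y => f y * g y) x + iteratedDeriv 3 f x)
      + g x * (f x * deriv f x)) x := fun x => by
    have d0 := (hf.differentiable (by norm_num) x).hasDerivAt
    have d1 := (hf1.differentiable (by norm_num) x).hasDerivAt
    have d2 := (hf2.differentiable (by norm_num) x).hasDerivAt
    have e0 := (hg.differentiable (by norm_num) x).hasDerivAt
    refine ((((d0.pow 2).mul e0).add (d0.mul d2)).sub
      ((d1.pow 2).div_const 2)).congr_deriv ?_
    have hfg : deriv (fun y => f y * g y) x = _ := (d0.mul e0).deriv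
    rw [hfg]
    simp only [iteratedDeriv_succ, iteratedDeriv_zero, Pi.pow_apply]
    push_cast
    ring
  have hcont : Continuous fun x => f x * (deriv (fun y => f y * g y) x + iteratedDeriv 3 f x)
      + g x * (f x * deriv f x) := by
    have c1 := ((hf.of_le (by norm_num)).mul hg).continuous_deriv le_rfl
    have c2 := hf.continuous_iteratedDeriv 3 le_rfl
    have c3 := hf1.continuous
    have c4 := hf.continuous
    have c5 := hg.continuous
    fun_prop
  rw [intervalIntegral.integral_eq_sub_of_hasDerivAt (fun x _ => hderiv x)
    (hcont.intervalIntegrable _ _)]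
  simp [G, hfper.eq, hgper.eq, hf1per.eq, hf2per.eq]

/-- Conservation of the L² quantity ∫(u² + v²) for smooth spatially periodic solutions
of the Drinfeld–Sokolov–Wilson system
  ∂ₜu + ∂ₓ(uv) + ∂ₓ³u = 0,  ∂ₜv + u ∂ₓu = 0. -/
theorem dsw_L2_conservation
    (L : ℝ) (hL : 0 < L) (u v : ℝ × ℝ → ℝ)
    (hu : ContDiff ℝ (⊤ : ℕ∞) u) (hv : ContDiff ℝ (⊤ : ℕ∞) v)
    (huper : ∀ t x : ℝ, u (t, x + L) = u (t, x))
    (hvper : ∀ t x : ℝ, v (t, x + L) = v (t, x))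
    (heq1 : ∀ t x : ℝ, deriv (fun s => u (s, x)) t
        + deriv (fun y => u (t, y) * v (t, y)) x
        + iteratedDeriv 3 (fun y => u (t, y)) x = 0)
    (heq2 : ∀ t x : ℝ, deriv (fun s => v (s, x)) t
        + u (t, x) * deriv (fun y => u (t, y)) x = 0) :
    ∀ t : ℝ, (∫ x in (0:ℝ)..L, (u (t, x) ^ 2 + v (t, x) ^ 2))
      = ∫ x in (0:ℝ)..L, (u (0, x) ^ 2 + v (0, x) ^ 2) := by
  intro t
  have hle (n : ℕ) : (n : WithTop ℕ∞) ≤ ((⊤ : ℕ∞) : WithTop ℕ∞) := by exact_mod_cast le_top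
  refine intervalIntegral_eq_of_integral_deriv_eq_zero (F := fun p => u p ^ 2 + v p ^ 2)
    (((hu.pow 2).add (hv.pow 2)).of_le (hle 1)) (fun s => ?_) 0 t
  have hflux := integral_dsw_energy_flux_eq_zero (f := fun x => u (s, x)) (g := fun x => v (s, x))
    ((hu.of_le (hle 3)).comp (by fun_prop)) ((hv.of_le (hle 1)).comp (by fun_prop))
    (huper s) (hvper s)
  have henergy : ∀ x, deriv (fun r => u (r, x) ^ 2 + v (r, x) ^ 2) s =
      -2 * (u (s, x) * (deriv (fun y => u (s, y) * v (s, y)) x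
        + iteratedDeriv 3 (fun y => u (s, y)) x)
      + v (s, x) * (u (s, x) * deriv (fun y => u (s, y)) x)) := fun x => by
    have du : HasDerivAt (fun r => u (r, x)) _ s :=
      ((hu.of_le (hle 1)).differentiable one_ne_zero |>.comp
        (by fun_prop : Differentiable ℝ fun r : ℝ => (r, x)) s).hasDerivAt
    have dv : HasDerivAt (fun r => v (r, x)) _ s :=
      ((hv.of_le (hle 1)).differentiable one_ne_zero |>.comp
        (by fun_prop : Differentiable ℝ fun r : ℝ => (r, x)) s).hasDerivAt
    have h1 := heq1 s x
    have h2 := heq2 s x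
    rw [du.deriv] at h1
    rw [dv.deriv] at h2
    refine ((du.pow 2).add (dv.pow 2)).deriv.trans ?_
    push_cast
    linear_combination 2 * u (s, x) * h1 + 2 * v (s, x) * h2
  simp_rw [henergy]
  rw [intervalIntegral.integral_const_mul, hflux, mul_zero]
end

section
/- Let L > 0 and let u, v : ℝ × ℝ → ℝ be smooth (C^∞) functions, L-periodic in the second (spatial) variable, solving the DSW system. Then the energy is conserved: for every t ∈ ℝ, ∫₀ᴸ ((∂_x u(t,x))² − u(t,x)² v(t,x)) dx = ∫₀ᴸ ((∂_x u(0,x))² − u(0,x)² v(0,x)) dx. -/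
open MeasureTheory Real

/-- The time derivative `∂ₜ f` of a function on space-time `ℝ × ℝ`. -/
noncomputable def timeDeriv (f : ℝ × ℝ → ℝ) (p : ℝ × ℝ) : ℝ := fderiv ℝ f p (1, 0)

/-- The space derivative `∂ₓ f` of a function on space-time `ℝ × ℝ`. -/
noncomputable def spaceDeriv (f : ℝ × ℝ → ℝ) (p : ℝ × ℝ) : ℝ := fderiv ℝ f p (0, 1)

section SpaceTime

variable {f : ℝ × ℝ → ℝ}

theorem contDiff_timeDeriv (hf : ContDiff ℝ (⊤ : ℕ∞) f) :
    ContDiff ℝ (⊤ : ℕ∞) (timeDeriv f) :=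
  (hf.fderiv_right (m := (⊤ : ℕ∞)) (by simp)).clm_apply contDiff_const

theorem contDiff_spaceDeriv (hf : ContDiff ℝ (⊤ : ℕ∞) f) :
    ContDiff ℝ (⊤ : ℕ∞) (spaceDeriv f) :=
  (hf.fderiv_right (m := (⊤ : ℕ∞)) (by simp)).clm_apply contDiff_const

theorem hasDerivAt_timeDeriv (hf : Differentiable ℝ f) (t x : ℝ) :
    HasDerivAt (fun s => f (s, x)) (timeDeriv f (t, x)) t :=
  (hf (t, x)).hasFDerivAt.comp_hasDerivAt t ((hasDerivAt_id t).prodMk (hasDerivAt_const t x))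

theorem hasDerivAt_spaceDeriv (hf : Differentiable ℝ f) (t x : ℝ) :
    HasDerivAt (fun y => f (t, y)) (spaceDeriv f (t, x)) x :=
  (hf (t, x)).hasFDerivAt.comp_hasDerivAt x ((hasDerivAt_const x t).prodMk (hasDerivAt_id x))

theorem timeDeriv_spaceDeriv_comm (hf : ContDiff ℝ (⊤ : ℕ∞) f) (p : ℝ × ℝ) :
    timeDeriv (spaceDeriv f) p = spaceDeriv (timeDeriv f) p := by
  have hd : DifferentiableAt ℝ (fderiv ℝ f) p :=
    (hf.fderiv_right (m := (⊤ : ℕ∞)) (by simp)).differentiable (by simp) p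
  have happly (w z : ℝ × ℝ) :
      fderiv ℝ (fun q => fderiv ℝ f q w) p z = fderiv ℝ (fderiv ℝ f) p z w := by
    rw [fderiv_clm_apply hd (differentiableAt_const w)]
    simp
  have hsymm : IsSymmSndFDerivAt ℝ f p :=
    (contDiff_infty.1 hf 2).contDiffAt.isSymmSndFDerivAt (by simp)
  exact (happly _ _).trans ((hsymm _ _).trans (happly _ _).symm)

theorem timeDeriv_periodic (hf : Differentiable ℝ f) {L : ℝ}
    (hper : ∀ t x : ℝ, f (t, x + L) = f (t, x)) (t x : ℝ) :
    timeDeriv f (t, x + L) = timeDeriv f (t, x) := by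
  rw [← (hasDerivAt_timeDeriv hf t (x + L)).deriv, ← (hasDerivAt_timeDeriv hf t x).deriv]
  simp only [hper]

theorem spaceDeriv_periodic (hf : Differentiable ℝ f) {L : ℝ}
    (hper : ∀ t x : ℝ, f (t, x + L) = f (t, x)) (t x : ℝ) :
    spaceDeriv f (t, x + L) = spaceDeriv f (t, x) := by
  rw [← (hasDerivAt_spaceDeriv hf t (x + L)).deriv, ← (hasDerivAt_spaceDeriv hf t x).deriv,
    ← deriv_comp_add_const]
  simp only [hper]

/-- A density `e` with a spatially periodic flux `F`, so that `∂ₜ e = ∂ₓ F`, has a conserved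
integral. -/
theorem integral_eq_of_timeDeriv_eq_spaceDeriv {e F : ℝ × ℝ → ℝ} {L : ℝ}
    (he : Differentiable ℝ e) (hF : Differentiable ℝ F)
    (hbalance : ∀ p, timeDeriv e p = spaceDeriv F p)
    (hper : ∀ t, F (t, L) = F (t, 0)) (s t : ℝ) :
    ∫ x in (0 : ℝ)..L, e (t, x) = ∫ x in (0 : ℝ)..L, e (s, x) := by
  have hzero (p : ℝ × ℝ) : fderiv ℝ e p (1, 0) + (-fderiv ℝ F p) (0, 1) = 0 := by
    have := hbalance p
    simp only [timeDeriv, spaceDeriv] at this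
    simp [this]
  have hdiv := integral2_divergence_prod_of_hasFDerivAt
    e (fun p => -F p) (fderiv ℝ e) (fun p => -fderiv ℝ F p) s 0 t L
    he.continuous.continuousOn hF.continuous.neg.continuousOn
    (fun p _ => (he p).hasFDerivAt) (fun p _ => (hF p).hasFDerivAt.neg)
    (by simp only [hzero]; exact integrableOn_zero)
  simp only [hzero, hper, intervalIntegral.integral_zero] at hdiv
  linarith

end SpaceTime

/-- Conservation of the energy ∫((∂ₓu)² − u²v) for smooth spatially periodic solutions
of the Drinfeld–Sokolov–Wilson system
  ∂ₜu + ∂ₓ(uv) + ∂ₓ³u = 0,  ∂ₜv + u ∂ₓu = 0. -/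
theorem dsw_energy_conservation
    (L : ℝ) (hL : 0 < L) (u v : ℝ × ℝ → ℝ)
    (hu : ContDiff ℝ (⊤ : ℕ∞) u) (hv : ContDiff ℝ (⊤ : ℕ∞) v)
    (huper : ∀ t x : ℝ, u (t, x + L) = u (t, x))
    (hvper : ∀ t x : ℝ, v (t, x + L) = v (t, x))
    (heq1 : ∀ t x : ℝ, deriv (fun s => u (s, x)) t
        + deriv (fun y => u (t, y) * v (t, y)) x
        + iteratedDeriv 3 (fun y => u (t, y)) x = 0)
    (heq2 : ∀ t x : ℝ, deriv (fun s => v (s, x)) t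
        + u (t, x) * deriv (fun y => u (t, y)) x = 0) :
    ∀ t : ℝ, (∫ x in (0:ℝ)..L,
        ((deriv (fun y => u (t, y)) x) ^ 2 - u (t, x) ^ 2 * v (t, x)))
      = ∫ x in (0:ℝ)..L,
        ((deriv (fun y => u (0, y)) x) ^ 2 - u (0, x) ^ 2 * v (0, x)) := by
  have smooth_diff {f : ℝ × ℝ → ℝ} (hf : ContDiff ℝ (⊤ : ℕ∞) f) : Differentiable ℝ f :=
    hf.differentiable (by simp)
  have hux := contDiff_spaceDeriv hu
  have huxx := contDiff_spaceDeriv hux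
  have hut := contDiff_timeDeriv hu
  have hderiv {f : ℝ × ℝ → ℝ} (hf : ContDiff ℝ (⊤ : ℕ∞) f) (t : ℝ) :
      deriv (fun y => f (t, y)) = fun y => spaceDeriv f (t, y) :=
    funext fun x => (hasDerivAt_spaceDeriv (smooth_diff hf) t x).deriv
  have heq_u (t x : ℝ) : timeDeriv u (t, x)
      + (spaceDeriv u (t, x) * v (t, x) + u (t, x) * spaceDeriv v (t, x))
      + spaceDeriv (spaceDeriv (spaceDeriv u)) (t, x) = 0 := by
    have h := heq1 t x
    rw [(hasDerivAt_timeDeriv (smooth_diff hu) t x).deriv,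
      ((hasDerivAt_spaceDeriv (smooth_diff hu) t x).fun_mul
        (hasDerivAt_spaceDeriv (smooth_diff hv) t x)).deriv] at h
    simpa only [iteratedDeriv_succ, iteratedDeriv_zero, hderiv hu, hderiv hux, hderiv huxx]
      using h
  have heq_v (t x : ℝ) : timeDeriv v (t, x) + u (t, x) * spaceDeriv u (t, x) = 0 := by
    have h := heq2 t x
    rwa [(hasDerivAt_timeDeriv (smooth_diff hv) t x).deriv, hderiv hu] at h
  have he : ContDiff ℝ (⊤ : ℕ∞) (fun p => spaceDeriv u p ^ 2 - u p ^ 2 * v p) := by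
    fun_prop
  have hF : ContDiff ℝ (⊤ : ℕ∞) (fun p => 2 * (spaceDeriv u p * timeDeriv u p)
      + (u p * v p + spaceDeriv (spaceDeriv u) p) ^ 2 + u p ^ 4 / 4) := by
    fun_prop
  intro t
  simp only [hderiv hu]
  refine integral_eq_of_timeDeriv_eq_spaceDeriv (smooth_diff he) (smooth_diff hF) ?_ ?_ 0 t
  · rintro ⟨t, x⟩
    have het := ((hasDerivAt_timeDeriv (smooth_diff hux) t x).fun_pow 2).fun_sub
      (((hasDerivAt_timeDeriv (smooth_diff hu) t x).fun_pow 2).fun_mul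
        (hasDerivAt_timeDeriv (smooth_diff hv) t x))
    have du := hasDerivAt_spaceDeriv (smooth_diff hu) t x
    have dv := hasDerivAt_spaceDeriv (smooth_diff hv) t x
    have hFx := ((((hasDerivAt_spaceDeriv (smooth_diff hux) t x).fun_mul
        (hasDerivAt_spaceDeriv (smooth_diff hut) t x)).const_mul 2).fun_add
      (((du.fun_mul dv).fun_add (hasDerivAt_spaceDeriv (smooth_diff huxx) t x)).fun_pow 2)).fun_add
      ((du.fun_pow 4).div_const 4)
    rw [(hasDerivAt_timeDeriv (smooth_diff he) t x).unique het,
      (hasDerivAt_spaceDeriv (smooth_diff hF) t x).unique hFx,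
      timeDeriv_spaceDeriv_comm hu]
    norm_num
    linear_combination (-u (t, x) ^ 2) * heq_v t x
      - 2 * (u (t, x) * v (t, x) + spaceDeriv (spaceDeriv u) (t, x)) * heq_u t x
  · intro t
    have hux_per := spaceDeriv_periodic (smooth_diff hu) huper
    have hper {f : ℝ × ℝ → ℝ} (hf : ∀ t x : ℝ, f (t, x + L) = f (t, x)) :
        f (t, L) = f (t, 0) := by
      simpa using hf t 0
    simp only [hper huper, hper hvper, hper hux_per,
      hper (timeDeriv_periodic (smooth_diff hu) huper),
      hper (spaceDeriv_periodic (smooth_diff hux) hux_per)]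
end

section
/- Let L > 0, let u : ℝ → ℝ be continuously differentiable and L-periodic, and let v : ℝ → ℝ be continuous and L-periodic. Set A = ∫₀ᴸ (u'(x)² − u(x)² v(x)) dx and B = ∫₀ᴸ (u(x)² + v(x)²) dx. Then ∫₀ᴸ u'(x)² dx ≤ 2A + 2B^{3/2}/√L + 4LB². (This is the a priori H¹ bound derived from the two conserved quantities of the DSW system, via the periodic Gagliardo–Nirenberg inequality ‖u‖_∞² ≤ (1/L)∫₀ᴸ u² + 2(∫₀ᴸ u²)^{1/2}(∫₀ᴸ u'²)^{1/2}.) -/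
open MeasureTheory Real

/-- The Cauchy–Schwarz inequality for interval integrals of continuous functions. -/
lemma intervalIntegral_mul_le_sqrt_mul_sqrt {a b : ℝ} (hab : a ≤ b) {f g : ℝ → ℝ}
    (hf : Continuous f) (hg : Continuous g) :
    ∫ x in a..b, f x * g x ≤ √(∫ x in a..b, f x ^ 2) * √(∫ x in a..b, g x ^ 2) := by
  have hnonneg (h : ℝ → ℝ) : 0 ≤ ∫ x in a..b, h x ^ 2 :=
    intervalIntegral.integral_nonneg hab fun x _ => sq_nonneg _
  have hquad (t : ℝ) : 0 ≤ (∫ x in a..b, g x ^ 2) * (t * t)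
      + (-2 * ∫ x in a..b, f x * g x) * t + ∫ x in a..b, f x ^ 2 := by
    have hexp : ∫ x in a..b, (f x - t * g x) ^ 2 = ∫ x in a..b,
        (t * t * g x ^ 2 + -2 * t * (f x * g x) + f x ^ 2) := by
      congr 1
      ext x
      ring
    have h := hnonneg fun x => f x - t * g x
    rw [hexp, intervalIntegral.integral_add
      (Continuous.intervalIntegrable (by fun_prop) _ _)
      (Continuous.intervalIntegrable (by fun_prop) _ _), intervalIntegral.integral_add
      (Continuous.intervalIntegrable (by fun_prop) _ _)
      (Continuous.intervalIntegrable (by fun_prop) _ _),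
      intervalIntegral.integral_const_mul, intervalIntegral.integral_const_mul] at h
    linarith
  have hdisc := discrim_le_zero hquad
  rw [discrim] at hdisc
  rw [← Real.sqrt_mul (hnonneg f)]
  exact Real.le_sqrt_of_sq_le (by linarith)

/-- A Gagliardo–Nirenberg inequality on the interval `[0, L]`. -/
lemma sq_le_integral_sq_div_add {L : ℝ} (hL : 0 < L) {u : ℝ → ℝ} (hu : ContDiff ℝ 1 u)
    {x : ℝ} (hx : x ∈ Set.Icc 0 L) :
    u x ^ 2 ≤ (∫ y in (0:ℝ)..L, u y ^ 2) / L
      + 2 * (√(∫ y in (0:ℝ)..L, u y ^ 2) * √(∫ y in (0:ℝ)..L, deriv u y ^ 2)) := by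
  have hcu : Continuous u := hu.continuous
  have hcd : Continuous (deriv u) := hu.continuous_deriv le_rfl
  have hcs : √(∫ y in (0:ℝ)..L, u y ^ 2) * √(∫ y in (0:ℝ)..L, deriv u y ^ 2)
      ≥ ∫ y in (0:ℝ)..L, |u y| * |deriv u y| := by
    simpa only [sq_abs] using intervalIntegral_mul_le_sqrt_mul_sqrt hL.le hcu.abs hcd.abs
  set C := √(∫ y in (0:ℝ)..L, u y ^ 2) * √(∫ y in (0:ℝ)..L, deriv u y ^ 2)
  have hpt (y : ℝ) (hy : y ∈ Set.Icc 0 L) : u x ^ 2 - 2 * C ≤ u y ^ 2 := by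
    have hftc : ∫ t in y..x, 2 * (u t * deriv u t) = u x ^ 2 - u y ^ 2 := by
      refine intervalIntegral.integral_eq_sub_of_hasDerivAt (f := fun t => u t ^ 2)
        (fun t _ => ?_) (Continuous.intervalIntegrable (by fun_prop) _ _)
      simpa [mul_assoc] using (hu.differentiable one_ne_zero t).hasDerivAt.fun_pow 2
    rw [intervalIntegral.integral_const_mul] at hftc
    have habs : |∫ t in y..x, u t * deriv u t| ≤ ∫ t in (0:ℝ)..L, |u t| * |deriv u t| := by
      rw [← Real.norm_eq_abs]
      refine intervalIntegral.norm_integral_le_integral_norm_uIoc.trans ?_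
      rw [intervalIntegral.integral_of_le hL.le]
      simp only [Real.norm_eq_abs, abs_mul]
      refine setIntegral_mono_set ?_ (ae_of_all _ fun t => by positivity) ?_
      · exact (Continuous.intervalIntegrable (by fun_prop) 0 L).1
      · exact (Set.Ioc_subset_Ioc (le_min hy.1 hx.1) (max_le hy.2 hx.2)).eventuallyLE
    linarith [le_abs_self (∫ t in y..x, u t * deriv u t)]
  have hint := intervalIntegral.integral_mono_on hL.le
    (continuous_const.intervalIntegrable (μ := volume) 0 L)
    (Continuous.intervalIntegrable (by fun_prop) 0 L) hpt
  rw [intervalIntegral.integral_const, smul_eq_mul, sub_zero] at hint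
  have := (le_div_iff₀' hL).2 hint
  linarith

/-- A priori H¹ bound from the two conserved quantities of the DSW system:
with A = ∫(u'² − u²v) and B = ∫(u² + v²) over one period, one has
∫ u'² ≤ 2A + 2B^{3/2}/√L + 4LB². -/
theorem dsw_h1_apriori_bound
    (L : ℝ) (hL : 0 < L) (u v : ℝ → ℝ)
    (hu : ContDiff ℝ 1 u) (hv : Continuous v)
    (huper : ∀ x : ℝ, u (x + L) = u x) (hvper : ∀ x : ℝ, v (x + L) = v x)
    (A B : ℝ)
    (hA : A = ∫ x in (0:ℝ)..L, ((deriv u x) ^ 2 - (u x) ^ 2 * v x))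
    (hB : B = ∫ x in (0:ℝ)..L, ((u x) ^ 2 + (v x) ^ 2)) :
    (∫ x in (0:ℝ)..L, (deriv u x) ^ 2)
      ≤ 2 * A + 2 * B ^ ((3 : ℝ) / 2) / Real.sqrt L + 4 * L * B ^ 2 := by
  have hcu : Continuous u := hu.continuous
  have hcd : Continuous (deriv u) := hu.continuous_deriv le_rfl
  have hnonneg (h : ℝ → ℝ) : 0 ≤ ∫ x in (0:ℝ)..L, h x ^ 2 :=
    intervalIntegral.integral_nonneg hL.le fun x _ => sq_nonneg _
  rw [intervalIntegral.integral_sub (Continuous.intervalIntegrable (by fun_prop) _ _)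
    (Continuous.intervalIntegrable (by fun_prop) _ _)] at hA
  rw [intervalIntegral.integral_add (Continuous.intervalIntegrable (by fun_prop) _ _)
    (Continuous.intervalIntegrable (by fun_prop) _ _)] at hB
  have hv1 : ∫ x in (0:ℝ)..L, |v x| ≤ √L * √(∫ x in (0:ℝ)..L, v x ^ 2) := by
    simpa using intervalIntegral_mul_le_sqrt_mul_sqrt hL.le
      (continuous_const (y := (1 : ℝ))) hv.abs
  have hsup := fun x => sq_le_integral_sq_div_add hL hu (x := x)
  set K := (∫ y in (0:ℝ)..L, u y ^ 2) / L
      + 2 * (√(∫ y in (0:ℝ)..L, u y ^ 2) * √(∫ y in (0:ℝ)..L, deriv u y ^ 2)) with hK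
  have hcub : ∫ x in (0:ℝ)..L, u x ^ 2 * v x ≤ K * ∫ x in (0:ℝ)..L, |v x| := by
    rw [← intervalIntegral.integral_const_mul]
    refine intervalIntegral.integral_mono_on hL.le
      (Continuous.intervalIntegrable (by fun_prop) _ _)
      (Continuous.intervalIntegrable (by fun_prop) _ _) fun x hx => ?_
    exact (mul_le_mul_of_nonneg_left (le_abs_self _) (sq_nonneg _)).trans
      (mul_le_mul_of_nonneg_right (hsup x hx) (abs_nonneg _))
  have ha := hnonneg u
  have hb := hnonneg v
  have hd := hnonneg (deriv u)
  have hK0 : 0 ≤ K := by positivity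
  replace hcub := hcub.trans (mul_le_mul_of_nonneg_left hv1 hK0)
  have hB0 : 0 ≤ B := by rw [hB]; positivity
  have hα : √(∫ x in (0:ℝ)..L, u x ^ 2) ≤ √B := Real.sqrt_le_sqrt (by linarith)
  have hβ : √(∫ x in (0:ℝ)..L, v x ^ 2) ≤ √B := Real.sqrt_le_sqrt (by linarith)
  have hpow : B ^ ((3 : ℝ) / 2) = √B ^ 3 := by
    rw [Real.sqrt_eq_rpow, ← Real.rpow_natCast, ← Real.rpow_mul hB0]
    norm_num
  rw [hpow]
  have hl : 0 < √L := Real.sqrt_pos.2 hL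
  have ha' := Real.sq_sqrt ha
  have hd' := Real.sq_sqrt hd
  have hL' := Real.sq_sqrt hL.le
  have hB' := Real.sq_sqrt hB0
  have hα0 := Real.sqrt_nonneg (∫ x in (0:ℝ)..L, u x ^ 2)
  have hβ0 := Real.sqrt_nonneg (∫ x in (0:ℝ)..L, v x ^ 2)
  set a := ∫ x in (0:ℝ)..L, u x ^ 2
  set d := ∫ x in (0:ℝ)..L, deriv u x ^ 2
  set α := √a
  set β := √(∫ x in (0:ℝ)..L, v x ^ 2)
  set δ := √d
  set l := √L
  set s := √B
  have hKe : K * (l * β) = α ^ 2 * β / l + 2 * (α * δ * l * β) := by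
    rw [hK, ← ha', ← hL']
    field_simp
  have hcubic : α ^ 2 * β / l ≤ s ^ 3 / l := by
    rw [pow_succ s 2]
    gcongr
  have hquart : L * (α * β) ^ 2 ≤ L * B ^ 2 := by
    rw [← hB', sq s]
    gcongr
  have hyoung := sq_nonneg (δ - 2 * (α * l * β))
  have hmul : (α * l * β) ^ 2 = L * (α * β) ^ 2 := by rw [← hL']; ring
  have hdiv : 2 * s ^ 3 / l = 2 * (s ^ 3 / l) := by ring
  rw [hdiv]
  linarith
end

section
/- Let c > 0 and 2c/√3 < η₄ < 2c. Define η₁ = −(√(16c² − 3η₄²) + η₄)/2, η₃ = (√(16c² − 3η₄²) − η₄)/2, r = 16c²η₄² − 3η₄⁴, and the elliptic-modulus squared κ² = −(η₁/η₄)·(η₄ − η₃)/(η₃ − η₁). Then r > 0, κ² = (3η₄² − 8c² + √r)/(2√r), and 0 < κ² < 1. -/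
open Real

/-- The elliptic modulus squared κ² = −(η₁/η₄)·(η₄ − η₃)/(η₃ − η₁) of the DSW
periodic traveling wave equals (3η₄² − 8c² + √r)/(2√r) with r = 16c²η₄² − 3η₄⁴,
and it lies in (0,1). -/
theorem dsw_modulus_formula
    (c η₁ η₃ η₄ r κsq : ℝ) (hc : 0 < c)
    (hlo : 2 * c / Real.sqrt 3 < η₄) (hhi : η₄ < 2 * c)
    (hη₁ : η₁ = -(Real.sqrt (16 * c ^ 2 - 3 * η₄ ^ 2) + η₄) / 2)
    (hη₃ : η₃ = (Real.sqrt (16 * c ^ 2 - 3 * η₄ ^ 2) - η₄) / 2)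
    (hr : r = 16 * c ^ 2 * η₄ ^ 2 - 3 * η₄ ^ 4)
    (hκsq : κsq = -(η₁ / η₄) * (η₄ - η₃) / (η₃ - η₁)) :
    0 < r ∧
    κsq = (3 * η₄ ^ 2 - 8 * c ^ 2 + Real.sqrt r) / (2 * Real.sqrt r) ∧
    0 < κsq ∧ κsq < 1 := by
  have h3 : 0 < Real.sqrt 3 := by positivity
  have he : 0 < η₄ := lt_trans (by positivity) hlo
  have hlo' : 4 * c ^ 2 < 3 * η₄ ^ 2 := by
    have h := (div_lt_iff₀ h3).1 hlo
    have h2 : (2 * c) ^ 2 < (η₄ * Real.sqrt 3) ^ 2 := pow_lt_pow_left₀ h (by positivity) two_ne_zero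
    rw [mul_pow, mul_pow, Real.sq_sqrt (by norm_num)] at h2
    linarith
  have hhi' : η₄ ^ 2 < 4 * c ^ 2 := by nlinarith
  have hpos : 0 < 16 * c ^ 2 - 3 * η₄ ^ 2 := by nlinarith
  have hsq := Real.sq_sqrt hpos.le
  have hs := Real.sqrt_pos.2 hpos
  set s := Real.sqrt (16 * c ^ 2 - 3 * η₄ ^ 2)
  have hrs : r = (η₄ * s) ^ 2 := by rw [hr, mul_pow, hsq]; ring
  have hsqrt : Real.sqrt r = η₄ * s := by rw [hrs, Real.sqrt_sq (by positivity)]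
  have hes : η₄ < s := lt_of_pow_lt_pow_left₀ 2 hs.le (by linarith)
  have hse : s < 3 * η₄ := lt_of_pow_lt_pow_left₀ 2 (by positivity) (by nlinarith)
  have hκ : κsq = (s + η₄) * (3 * η₄ - s) / (4 * (η₄ * s)) := by
    have hd : η₃ - η₁ = s := by rw [hη₁, hη₃]; ring
    rw [hκsq, hd, hη₁, hη₃]
    field_simp
    ring
  refine ⟨by rw [hrs]; positivity, ?_, ?_, ?_⟩
  · rw [hκ, hsqrt, div_eq_div_iff (by positivity) (by positivity)]
    linear_combination (-2 * (η₄ * s)) * hsq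
  · rw [hκ]
    have := sub_pos.2 hse
    positivity
  · rw [hκ, div_lt_one (by positivity)]
    nlinarith [mul_pos (sub_pos.2 hes) (by positivity : 0 < 3 * η₄ + s)]
end

section
/- Let K(m) = ∫₀^{π/2} (1 − m² sin²θ)^{−1/2} dθ for 0 ≤ m < 1 (the complete elliptic integral of the first kind). Let 0 < κ < 1 and L > 0, and define h = 4√(1 − κ² + κ⁴), c = 4K(κ)²h/L², and η₄ = (8√2 K(κ)²/(√3 L²))·√(h(h + 2(2κ² − 1))). Then 2c/√3 < η₄ < 2c, r := 16c²η₄² − 3η₄⁴ > 0, κ² = (3η₄² − 8c² + √r)/(2√r), and the period condition 8√c · K(κ)/r^{1/4} = L holds. -/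
open Real

/-- The complete elliptic integral of the first kind. -/
noncomputable def Kell (m : ℝ) : ℝ :=
  ∫ θ in (0:ℝ)..(Real.pi / 2), 1 / Real.sqrt (1 - m ^ 2 * Real.sin θ ^ 2)

theorem Kell_pos {m : ℝ} (hm0 : 0 ≤ m) (hm1 : m < 1) : 0 < Kell m := by
  have hpos : ∀ θ : ℝ, 0 < 1 - m ^ 2 * Real.sin θ ^ 2 := fun θ ↦ by
    nlinarith [Real.sin_sq_le_one θ, sq_nonneg (Real.sin θ)]
  have hcont : Continuous fun θ : ℝ ↦ 1 / Real.sqrt (1 - m ^ 2 * Real.sin θ ^ 2) :=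
    continuous_const.div (by fun_prop) fun θ ↦ (Real.sqrt_pos.2 (hpos θ)).ne'
  exact intervalIntegral.intervalIntegral_pos_of_pos (hcont.intervalIntegrable _ _)
    (fun θ ↦ one_div_pos.2 (Real.sqrt_pos.2 (hpos θ))) Real.pi_div_two_pos

/-- The explicit parametrization of the DSW periodic waves by the elliptic modulus:
with h = 4√(1 − κ² + κ⁴), c = 4K(κ)²h/L² and
η₄ = (8√2 K(κ)²/(√3 L²))√(h(h + 2(2κ² − 1))), one has 2c/√3 < η₄ < 2c,
r = 16c²η₄² − 3η₄⁴ > 0, κ² = (3η₄² − 8c² + √r)/(2√r), and the period condition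
8√c K(κ)/r^{1/4} = L. -/
theorem dsw_parametrization_by_modulus
    (κ L h c η₄ r : ℝ) (hκ0 : 0 < κ) (hκ1 : κ < 1) (hL : 0 < L)
    (hh : h = 4 * Real.sqrt (1 - κ ^ 2 + κ ^ 4))
    (hc : c = 4 * Kell κ ^ 2 * h / L ^ 2)
    (hη₄ : η₄ = (8 * Real.sqrt 2 * Kell κ ^ 2 / (Real.sqrt 3 * L ^ 2))
        * Real.sqrt (h * (h + 2 * (2 * κ ^ 2 - 1))))
    (hr : r = 16 * c ^ 2 * η₄ ^ 2 - 3 * η₄ ^ 4) :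
    2 * c / Real.sqrt 3 < η₄ ∧ η₄ < 2 * c ∧
    0 < r ∧
    κ ^ 2 = (3 * η₄ ^ 2 - 8 * c ^ 2 + Real.sqrt r) / (2 * Real.sqrt r) ∧
    8 * Real.sqrt c * Kell κ / r ^ ((1 : ℝ) / 4) = L := by
  have hK : 0 < Kell κ := Kell_pos hκ0.le hκ1
  set K := Kell κ
  obtain ⟨A, hA⟩ : ∃ A, A = K ^ 2 / L ^ 2 := ⟨_, rfl⟩
  have hA0 : 0 < A := hA ▸ by positivity
  obtain ⟨s, hs⟩ : ∃ s, s = 2 * κ ^ 2 - 1 := ⟨_, rfl⟩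
  have hs1 : s < 1 := by nlinarith
  have hs0 : -1 < s := by nlinarith
  have hquad : 0 < 1 - κ ^ 2 + κ ^ 4 := by nlinarith [sq_nonneg (κ ^ 2 - 1 / 2)]
  have hh0 : 0 < h := hh ▸ by positivity
  have hh2 : h ^ 2 = 4 * s ^ 2 + 12 := by
    rw [hh, mul_pow, Real.sq_sqrt hquad.le, hs]; ring
  have hlow : -(4 * s) < h := by nlinarith
  have hup : 4 * s < h := by nlinarith
  have hc' : c = 4 * A * h := by rw [hc, hA]; ring
  have hc0 : 0 < c := hc' ▸ by positivity
  have hsum : 0 < h + 2 * s := by linarith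
  have hη0 : 0 < η₄ := by
    rw [hη₄, ← hs]; positivity
  have hη2 : η₄ ^ 2 = 128 / 3 * A ^ 2 * (h * (h + 2 * s)) := by
    rw [hη₄, ← hs, mul_pow, Real.sq_sqrt (by positivity), div_pow, mul_pow, mul_pow, mul_pow,
      Real.sq_sqrt (by norm_num), Real.sq_sqrt (by norm_num), hA]
    ring
  have hr' : r = (256 * A ^ 2 * h) ^ 2 := by
    have hη4 : η₄ ^ 4 = (η₄ ^ 2) ^ 2 := by ring
    rw [hr, hη4, hη2, hc']
    linear_combination (16384 / 3) * A ^ 4 * h ^ 2 * hh2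
  have hsqrt : Real.sqrt r = 256 * A ^ 2 * h := by
    rw [hr', Real.sqrt_sq (by positivity)]
  have hroot : r ^ ((1 : ℝ) / 4) = 16 * A * Real.sqrt h := by
    have hfour : r = (16 * A * Real.sqrt h) ^ (4 : ℕ) := by
      have hsq : Real.sqrt h ^ 4 = h ^ 2 := by
        rw [show 4 = 2 * 2 from rfl, pow_mul, Real.sq_sqrt hh0.le]
      rw [hr', mul_pow _ (Real.sqrt h), hsq]; ring
    rw [hfour, one_div]
    exact Real.pow_rpow_inv_natCast (by positivity) (by norm_num)
  refine ⟨?_, ?_, ?_, ?_, ?_⟩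
  · refine lt_of_pow_lt_pow_left₀ 2 hη0.le ?_
    rw [div_pow, Real.sq_sqrt (by norm_num), hη2, hc']
    have : 0 < A ^ 2 * h * (h + 4 * s) := mul_pos (by positivity) (by linarith)
    linarith
  · refine lt_of_pow_lt_pow_left₀ 2 (by positivity) ?_
    rw [hη2, hc']
    have : 0 < A ^ 2 * h * (h - 4 * s) := mul_pos (by positivity) (by linarith)
    linarith
  · rw [hr']; positivity
  · rw [hsqrt, hη2, hc', eq_div_iff (by positivity), hs]
    ring
  · have hsc : Real.sqrt c = 2 * (K / L) * Real.sqrt h := by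
      rw [show c = (2 * (K / L)) ^ 2 * h by rw [hc', hA]; ring, Real.sqrt_mul (by positivity),
        Real.sqrt_sq (by positivity)]
    have hsh : 0 < Real.sqrt h := Real.sqrt_pos.2 hh0
    rw [hroot, hsc, hA]
    field_simp
    norm_num
end

section
/- For c > 0 and 2c/√3 < η < 2c, set r(η,c) = 16c²η² − 3η⁴, κ(η,c) = √((3η² − 8c² + √(r(η,c)))/(2√(r(η,c)))), and G(η,c) = 8√c · K(κ(η,c))/r(η,c)^{1/4}, where K(m) = ∫₀^{π/2} (1 − m² sin²θ)^{−1/2} dθ. Then ∂G/∂η (η,c) > 0 on this domain; that is, the fundamental period of the traveling wave is a strictly increasing function of the amplitude η. -/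
open Real

/-- r(η,c) = 16c²η² − 3η⁴. -/
noncomputable def rfun (η c : ℝ) : ℝ := 16 * c ^ 2 * η ^ 2 - 3 * η ^ 4

/-- The elliptic modulus κ(η,c) = √((3η² − 8c² + √r)/(2√r)). -/
noncomputable def kfun (η c : ℝ) : ℝ :=
  Real.sqrt ((3 * η ^ 2 - 8 * c ^ 2 + Real.sqrt (rfun η c)) / (2 * Real.sqrt (rfun η c)))

/-- The fundamental period G(η,c) = 8√c·K(κ(η,c))/r(η,c)^{1/4} of the traveling wave. -/
noncomputable def Gfun (η c : ℝ) : ℝ :=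
  8 * Real.sqrt c * Kell (kfun η c) / (rfun η c) ^ ((1 : ℝ) / 4)

/-- The complete elliptic integral of the first kind in terms of the parameter `m = k ^ 2`. -/
noncomputable def ellipticKParam (m : ℝ) : ℝ :=
  ∫ θ in (0:ℝ)..(Real.pi / 2), 1 / Real.sqrt (1 - m * Real.sin θ ^ 2)

/-- The derivative of `ellipticKParam`. -/
noncomputable def ellipticKParamDeriv (m : ℝ) : ℝ :=
  ∫ θ in (0:ℝ)..(Real.pi / 2),
    Real.sin θ ^ 2 / (2 * ((1 - m * Real.sin θ ^ 2) * Real.sqrt (1 - m * Real.sin θ ^ 2)))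

theorem one_sub_mul_sin_sq_ge {m b : ℝ} (hb : 0 ≤ b) (hmb : m ≤ b) (θ : ℝ) :
    1 - b ≤ 1 - m * Real.sin θ ^ 2 := by
  nlinarith [sq_nonneg (Real.sin θ), Real.sin_sq_le_one θ]

theorem one_sub_mul_sin_sq_pos {m : ℝ} (h0 : 0 ≤ m) (h1 : m < 1) (θ : ℝ) :
    0 < 1 - m * Real.sin θ ^ 2 := by
  linarith [one_sub_mul_sin_sq_ge h0 le_rfl θ]

theorem hasDerivAt_one_div_sqrt_one_sub_mul {x s : ℝ} (h : 0 < 1 - x * s) :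
    HasDerivAt (fun y => 1 / Real.sqrt (1 - y * s))
      (s / (2 * ((1 - x * s) * Real.sqrt (1 - x * s)))) x := by
  have h1 : HasDerivAt (fun y => 1 - y * s) (-(1 * s)) x :=
    ((hasDerivAt_id x).mul_const s).const_sub 1
  have h2 := (h1.sqrt h.ne').inv (Real.sqrt_pos.2 h).ne'
  have hs := Real.sqrt_pos.2 h
  simp only [one_div]
  refine h2.congr_deriv ?_
  rw [Real.sq_sqrt h.le]
  field_simp

theorem continuous_ellipticK_integrand {m : ℝ} (h0 : 0 ≤ m) (h1 : m < 1) :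
    Continuous fun θ : ℝ => 1 / Real.sqrt (1 - m * Real.sin θ ^ 2) := by
  refine continuous_const.div (by fun_prop) fun θ => ?_
  exact (Real.sqrt_pos.2 (one_sub_mul_sin_sq_pos h0 h1 θ)).ne'

theorem continuous_ellipticK_deriv_integrand {m : ℝ} (h0 : 0 ≤ m) (h1 : m < 1) :
    Continuous fun θ : ℝ => Real.sin θ ^ 2 /
      (2 * ((1 - m * Real.sin θ ^ 2) * Real.sqrt (1 - m * Real.sin θ ^ 2))) := by
  refine Continuous.div (by fun_prop) (by fun_prop) fun θ => ?_
  have h := one_sub_mul_sin_sq_pos h0 h1 θ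
  have := Real.sqrt_pos.2 h
  positivity

theorem hasDerivAt_ellipticKParam {m : ℝ} (h0 : 0 ≤ m) (h1 : m < 1) :
    HasDerivAt ellipticKParam (ellipticKParamDeriv m) m := by
  obtain ⟨b, hmb, hb1⟩ := exists_between h1
  have hb0 : 0 ≤ b := h0.trans hmb.le
  refine (intervalIntegral.hasDerivAt_integral_of_dominated_loc_of_deriv_le
    (F := fun x θ => 1 / Real.sqrt (1 - x * Real.sin θ ^ 2))
    (F' := fun x θ => Real.sin θ ^ 2 /
      (2 * ((1 - x * Real.sin θ ^ 2) * Real.sqrt (1 - x * Real.sin θ ^ 2))))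
    (bound := fun _ => 1 / (2 * ((1 - b) * Real.sqrt (1 - b))))
    (Iio_mem_nhds hmb) (Filter.Eventually.of_forall fun x => ?_)
    ((continuous_ellipticK_integrand h0 h1).intervalIntegrable _ _)
    (continuous_ellipticK_deriv_integrand h0 h1).aestronglyMeasurable
    (Filter.Eventually.of_forall fun θ _ x hx => ?_)
    intervalIntegrable_const
    (Filter.Eventually.of_forall fun θ _ x hx => ?_)).2
  · exact Measurable.aestronglyMeasurable (by fun_prop)
  · have hge := one_sub_mul_sin_sq_ge hb0 (le_of_lt hx) θ
    have hb : 0 < 1 - b := by linarith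
    have hp : 0 < 1 - x * Real.sin θ ^ 2 := hb.trans_le hge
    have := Real.sqrt_pos.2 hb
    rw [Real.norm_of_nonneg (by positivity)]
    gcongr
    exact Real.sin_sq_le_one θ
  · exact hasDerivAt_one_div_sqrt_one_sub_mul
      (by linarith [one_sub_mul_sin_sq_ge hb0 (le_of_lt hx) θ])

theorem ellipticKParam_pos {m : ℝ} (h0 : 0 ≤ m) (h1 : m < 1) : 0 < ellipticKParam m := by
  refine intervalIntegral.intervalIntegral_pos_of_pos
    ((continuous_ellipticK_integrand h0 h1).intervalIntegrable _ _) (fun θ => ?_)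
    (by positivity)
  have := Real.sqrt_pos.2 (one_sub_mul_sin_sq_pos h0 h1 θ)
  positivity

theorem integral_two_mul_sin_sq_sub_one :
    ∫ θ in (0:ℝ)..(Real.pi / 2), (2 * Real.sin θ ^ 2 - 1) = 0 := by
  rw [intervalIntegral.integral_sub (Continuous.intervalIntegrable (by fun_prop) _ _)
    (by simp), intervalIntegral.integral_const_mul, integral_sin_sq]
  simp only [Real.sin_zero, Real.cos_zero, Real.sin_pi_div_two, Real.cos_pi_div_two,
    intervalIntegral.integral_const, smul_eq_mul]
  ring

/-- Pointwise form of Chebyshev's inequality behind `ellipticKParam_le_deriv`: the weight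
`(1 - m s) ^ (-3/2)` is increasing in `s`, so it may be replaced by its value at `s = 1 / 2`. -/
theorem two_mul_sub_one_mul_le {m s : ℝ} (h0 : 0 ≤ m) (h1 : m < 1) (hs0 : 0 ≤ s) (hs1 : s ≤ 1) :
    (2 * s - 1) * (1 / (4 * ((1 - m / 2) * Real.sqrt (1 - m / 2)))) ≤
      s / (2 * ((1 - m * s) * Real.sqrt (1 - m * s))) - 1 / 4 * (1 / Real.sqrt (1 - m * s)) := by
  have hp : 0 < 1 - m * s := by nlinarith
  have hq : 0 < 1 - m / 2 := by linarith
  have hps := Real.sqrt_pos.2 hp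
  have hqs := Real.sqrt_pos.2 hq
  have key : (2 * s - 1) * (1 / (4 * ((1 - m / 2) * Real.sqrt (1 - m / 2)))) ≤
      (2 * s - 1) * (1 / (4 * ((1 - m * s) * Real.sqrt (1 - m * s)))) := by
    rcases le_total s (1 / 2) with h | h
    · refine mul_le_mul_of_nonpos_left ?_ (by linarith)
      have : 1 - m / 2 ≤ 1 - m * s := by nlinarith
      gcongr
    · refine mul_le_mul_of_nonneg_left ?_ (by linarith)
      have : 1 - m * s ≤ 1 - m / 2 := by nlinarith
      gcongr
  refine key.trans ?_
  have hdiff : s / (2 * ((1 - m * s) * Real.sqrt (1 - m * s))) - 1 / 4 * (1 / Real.sqrt (1 - m * s))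
      - (2 * s - 1) * (1 / (4 * ((1 - m * s) * Real.sqrt (1 - m * s))))
      = m * s / (4 * ((1 - m * s) * Real.sqrt (1 - m * s))) := by
    have := hp.ne'
    set p := 1 - m * s with hpdef
    rw [show m * s = 1 - p by rw [hpdef]; ring]
    field_simp
    ring
  have : 0 ≤ m * s / (4 * ((1 - m * s) * Real.sqrt (1 - m * s))) := by positivity
  linarith

theorem ellipticKParam_le_deriv {m : ℝ} (h0 : 0 ≤ m) (h1 : m < 1) :
    1 / 4 * ellipticKParam m ≤ ellipticKParamDeriv m := by
  have hi := (continuous_ellipticK_integrand h0 h1).intervalIntegrable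
    (μ := MeasureTheory.volume) 0 (Real.pi / 2)
  have hi' := (continuous_ellipticK_deriv_integrand h0 h1).intervalIntegrable
    (μ := MeasureTheory.volume) 0 (Real.pi / 2)
  have hmono := intervalIntegral.integral_mono (μ := MeasureTheory.volume)
    (a := 0) (b := Real.pi / 2) (by positivity)
    (Continuous.intervalIntegrable (by fun_prop) _ _) (hi'.sub (hi.const_mul (1 / 4)))
    fun θ => two_mul_sub_one_mul_le h0 h1 (sq_nonneg (Real.sin θ)) (Real.sin_sq_le_one θ)
  rw [intervalIntegral.integral_mul_const, integral_two_mul_sin_sq_sub_one, zero_mul,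
    intervalIntegral.integral_sub hi' (hi.const_mul _), intervalIntegral.integral_const_mul]
    at hmono
  exact sub_nonneg.1 hmono

/-- The square of the elliptic modulus. -/
noncomputable def ksq (η c : ℝ) : ℝ :=
  (3 * η ^ 2 - 8 * c ^ 2 + Real.sqrt (rfun η c)) / (2 * Real.sqrt (rfun η c))

theorem rfun_gt_sq {c η : ℝ} (hc : 0 < c) (hlo : 2 * c / Real.sqrt 3 < η) (hhi : η < 2 * c) :
    (3 * η ^ 2 - 8 * c ^ 2) ^ 2 < rfun η c := by
  have h3 : (0:ℝ) < Real.sqrt 3 := by positivity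
  have hη : 0 < η := lt_trans (by positivity) hlo
  have h1 : 4 * c ^ 2 < 3 * η ^ 2 := by
    have h : 2 * c < η * Real.sqrt 3 := (div_lt_iff₀ h3).1 hlo
    have h' := pow_lt_pow_left₀ h (by positivity) two_ne_zero
    rw [mul_pow, mul_pow, Real.sq_sqrt (by norm_num)] at h'
    linarith
  have h2 : η ^ 2 < 4 * c ^ 2 := by nlinarith
  unfold rfun
  nlinarith [mul_pos (sub_pos.2 h1) (sub_pos.2 h2)]

theorem abs_lt_sqrt_of_sq_lt {x y : ℝ} (h : x ^ 2 < y) : |x| < Real.sqrt y := by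
  rw [← Real.sqrt_sq_eq_abs]
  exact Real.sqrt_lt_sqrt (sq_nonneg x) h

theorem ksq_mem {c η : ℝ} (h : (3 * η ^ 2 - 8 * c ^ 2) ^ 2 < rfun η c) :
    0 < ksq η c ∧ ksq η c < 1 := by
  have hs : 0 < Real.sqrt (rfun η c) := Real.sqrt_pos.2 ((sq_nonneg _).trans_lt h)
  obtain ⟨hl, hu⟩ := abs_lt.1 (abs_lt_sqrt_of_sq_lt h)
  refine ⟨div_pos (by linarith) (by positivity), (div_lt_one (by positivity)).2 (by linarith)⟩

theorem Kell_kfun {c η : ℝ} (h : 0 ≤ ksq η c) : Kell (kfun η c) = ellipticKParam (ksq η c) := by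
  have hk : kfun η c ^ 2 = ksq η c := Real.sq_sqrt h
  simp only [Kell, ellipticKParam, hk]

theorem hasDerivAt_rfun (c η : ℝ) :
    HasDerivAt (fun x => rfun x c) (-4 * η * (3 * η ^ 2 - 8 * c ^ 2)) η := by
  have h := ((hasDerivAt_pow 2 η).const_mul (16 * c ^ 2)).sub ((hasDerivAt_pow 4 η).const_mul 3)
  refine h.congr_deriv ?_
  norm_num
  ring

theorem hasDerivAt_ksq {c η : ℝ} (hr : 0 < rfun η c) :
    HasDerivAt (fun x => ksq x c)
      (η * (3 * rfun η c + (3 * η ^ 2 - 8 * c ^ 2) ^ 2) / Real.sqrt (rfun η c) ^ 3) η := by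
  have hs := Real.sqrt_pos.2 hr
  have h1 := (hasDerivAt_rfun c η).sqrt hr.ne'
  have h2 := (((hasDerivAt_pow 2 η).const_mul 3).sub_const (8 * c ^ 2)).add h1
  refine (h2.div (h1.const_mul 2) (by positivity)).congr_deriv ?_
  simp only [Pi.add_apply]
  have hsq := Real.sq_sqrt hr.le
  set s := Real.sqrt (rfun η c)
  rw [← hsq]
  field_simp
  norm_num
  ring

/-- The fundamental period of the DSW traveling wave is a strictly increasing function
of the amplitude η: ∂G/∂η > 0 on 2c/√3 < η < 2c. -/
theorem dsw_period_increasing_in_amplitude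
    (c η : ℝ) (hc : 0 < c) (hlo : 2 * c / Real.sqrt 3 < η) (hhi : η < 2 * c) :
    ∃ d : ℝ, HasDerivAt (fun η' => Gfun η' c) d η ∧ 0 < d := by
  have hη : 0 < η := lt_trans (by positivity) hlo
  have hgt := rfun_gt_sq hc hlo hhi
  have hr : 0 < rfun η c := (sq_nonneg _).trans_lt hgt
  obtain ⟨hk0, hk1⟩ := ksq_mem hgt
  have hkd := hasDerivAt_ksq hr
  have hK := (hasDerivAt_ellipticKParam hk0.le hk1).comp η hkd
  have hR := (hasDerivAt_rfun c η).rpow_const (p := (1:ℝ) / 4) (Or.inl hr.ne')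
  have hq : 0 < rfun η c ^ ((1:ℝ) / 4) := Real.rpow_pos_of_pos hr _
  have hG := (hK.const_mul (8 * Real.sqrt c)).div hR hq.ne'
  refine ⟨_, hG.congr_of_eventuallyEq ?_, ?_⟩
  · filter_upwards [hkd.continuousAt.eventually (lt_mem_nhds hk0)] with x hx
    simp [Gfun, Kell_kfun hx.le]
  · refine div_pos ?_ (by positivity)
    simp only [Function.comp_apply]
    rw [Real.rpow_sub_one hr.ne']
    have hKpos := ellipticKParam_pos hk0.le hk1
    have hKle := ellipticKParam_le_deriv hk0.le hk1
    have hs := Real.sqrt_pos.2 hr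
    have hl := (abs_lt.1 (abs_lt_sqrt_of_sq_lt hgt)).1
    have hsq := Real.sq_sqrt hr.le
    have hcs := Real.sqrt_pos.2 hc
    set s := Real.sqrt (rfun η c)
    set t := 3 * η ^ 2 - 8 * c ^ 2
    set q := rfun η c ^ ((1:ℝ) / 4)
    set K := ellipticKParam (ksq η c)
    set D := ellipticKParamDeriv (ksq η c)
    rw [← hsq]
    have hlog : 0 < D * (η * (3 * s ^ 2 + t ^ 2) / s ^ 3) + K * (η * t / s ^ 2) := by
      have hle : 1 / 4 * K * (η * (3 * s ^ 2 + t ^ 2) / s ^ 3) ≤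
          D * (η * (3 * s ^ 2 + t ^ 2) / s ^ 3) := by gcongr
      have hpos : 0 < K * η * ((t + s) * (t + 3 * s)) / (4 * s ^ 3) := by
        have : 0 < t + s := by linarith
        have : 0 < t + 3 * s := by linarith
        positivity
      have heq : 1 / 4 * K * (η * (3 * s ^ 2 + t ^ 2) / s ^ 3) + K * (η * t / s ^ 2) =
          K * η * ((t + s) * (t + 3 * s)) / (4 * s ^ 3) := by
        field_simp
        ring
      linarith
    have hmul : 0 < 8 * Real.sqrt c * q *
        (D * (η * (3 * s ^ 2 + t ^ 2) / s ^ 3) + K * (η * t / s ^ 2)) := by positivity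
    refine hmul.trans_eq ?_
    field_simp
    ring
end

section
/- Let L > 0 and 4π²/L² < c₁ < c₂. If η₁ ∈ (2c₁/√3, 2c₁) and η₂ ∈ (2c₂/√3, 2c₂) satisfy G(η₁, c₁) = L and G(η₂, c₂) = L, then κ(η₁, c₁) < κ(η₂, c₂). In other words, along the family of L-periodic waves, the elliptic modulus κ is a strictly increasing function of the wave speed c. -/
open Real

lemma rpow_one_div_four_eq_sqrt_sqrt {x : ℝ} (hx : 0 ≤ x) :
    x ^ ((1 : ℝ) / 4) = √(√x) := by
  rw [Real.sqrt_eq_rpow, Real.sqrt_eq_rpow, ← Real.rpow_mul hx]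
  norm_num

lemma quadratic_ratio_mono {α β x y : ℝ} (hyx : y ≤ x) (hy : 0 ≤ y) (hx : x < 1)
    (hαβ : β ≤ α) (hPx : 0 < 1 - x + β * x ^ 2) (hPy : 0 < 1 - y + β * y ^ 2) :
    (1 - y + α * y ^ 2) / (1 - y + β * y ^ 2) ≤ (1 - x + α * x ^ 2) / (1 - x + β * x ^ 2) := by
  rw [div_le_div_iff₀ hPy hPx]
  have h : 0 ≤ (α - β) * ((x - y) * (x + y * (1 - x))) :=
    mul_nonneg (by linarith) (mul_nonneg (by linarith)
      (add_nonneg (by linarith) (mul_nonneg hy (by linarith))))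
  nlinarith

lemma one_sub_mul_pos {m s : ℝ} (hm : 0 ≤ m) (hm1 : m < 1) (hs1 : s ≤ 1) :
    0 < 1 - m * s := by
  nlinarith [mul_nonneg hm (sub_nonneg.2 hs1)]

lemma symmetrized_integrand_eq {m s : ℝ} (hm : 0 ≤ m) (hm1 : m < 1) (hs : 0 ≤ s) (hs1 : s ≤ 1) :
    √(√(1 - m + m ^ 2)) * (1 / √(1 - m * s) + 1 / √(1 - m * (1 - s))) =
      √(√((1 - m + 1 * m ^ 2) / (1 - m + s * (1 - s) * m ^ 2)) *
        (2 * √((1 - m + 1 / 4 * m ^ 2) / (1 - m + s * (1 - s) * m ^ 2)) + 2)) := by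
  have ha := one_sub_mul_pos hm hm1 hs1
  have hb := one_sub_mul_pos hm hm1 (sub_le_self 1 hs)
  have hN : 0 ≤ 1 - m + m ^ 2 := by nlinarith [sq_nonneg m]
  have hP : 1 - m + s * (1 - s) * m ^ 2 = (1 - m * s) * (1 - m * (1 - s)) := by ring
  have hD : 1 - m + 1 / 4 * m ^ 2 = (1 - m / 2) ^ 2 := by ring
  rw [hP, hD, one_mul, eq_comm, Real.sqrt_eq_iff_mul_self_eq (by positivity) (by positivity),
    Real.sqrt_div hN, Real.sqrt_div (sq_nonneg _), Real.sqrt_sq (by linarith),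
    Real.sqrt_mul ha.le]
  have hsum : 2 * (1 - m / 2) = √(1 - m * s) ^ 2 + √(1 - m * (1 - s)) ^ 2 := by
    rw [Real.sq_sqrt ha.le, Real.sq_sqrt hb.le]; ring
  have hA := Real.sqrt_pos.2 ha
  have hB := Real.sqrt_pos.2 hb
  rw [← mul_div_assoc, hsum]
  generalize √(1 - m * s) = A at *
  generalize √(1 - m * (1 - s)) = B at *
  have hC := Real.mul_self_sqrt (Real.sqrt_nonneg (1 - m + m ^ 2))
  generalize √(√(1 - m + m ^ 2)) = C at *
  rw [← hC]
  field_simp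
  ring

lemma symmetrized_integrand_mono {x y s : ℝ} (hyx : y ≤ x) (hy : 0 ≤ y) (hx : x < 1)
    (hs : 0 ≤ s) (hs1 : s ≤ 1) :
    √(√(1 - y + y ^ 2)) * (1 / √(1 - y * s) + 1 / √(1 - y * (1 - s))) ≤
      √(√(1 - x + x ^ 2)) * (1 / √(1 - x * s) + 1 / √(1 - x * (1 - s))) := by
  have hσ : 0 ≤ s * (1 - s) := mul_nonneg hs (by linarith)
  have hσ' : s * (1 - s) ≤ 1 / 4 := by nlinarith [sq_nonneg (s - 1 / 2)]
  have hPx : 0 < 1 - x + s * (1 - s) * x ^ 2 :=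
    add_pos_of_pos_of_nonneg (by linarith) (by positivity)
  have hPy : 0 < 1 - y + s * (1 - s) * y ^ 2 :=
    add_pos_of_pos_of_nonneg (by linarith) (by positivity)
  have h1 := quadratic_ratio_mono hyx hy hx (hσ'.trans (by norm_num)) hPx hPy (α := 1)
  have h2 := quadratic_ratio_mono hyx hy hx hσ' hPx hPy
  rw [symmetrized_integrand_eq hy (hyx.trans_lt hx) hs hs1,
    symmetrized_integrand_eq (hy.trans hyx) hx hs hs1]
  exact Real.sqrt_le_sqrt (mul_le_mul (Real.sqrt_le_sqrt h1)
    (by linarith [Real.sqrt_le_sqrt h2]) (by positivity) (by positivity))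

lemma continuous_one_div_sqrt_one_sub_mul {m : ℝ} (hm : 0 ≤ m) (hm1 : m < 1) {f : ℝ → ℝ}
    (hf : Continuous f) (hf1 : ∀ θ, f θ ≤ 1) :
    Continuous fun θ => 1 / √(1 - m * f θ) :=
  continuous_const.div (by fun_prop)
    fun θ => (Real.sqrt_pos.2 (one_sub_mul_pos hm hm1 (hf1 θ))).ne'

lemma continuous_symmetrized_integrand {m : ℝ} (hm : 0 ≤ m) (hm1 : m < 1) :
    Continuous fun θ => 1 / √(1 - m * sin θ ^ 2) + 1 / √(1 - m * (1 - sin θ ^ 2)) :=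
  (continuous_one_div_sqrt_one_sub_mul hm hm1 (by fun_prop) Real.sin_sq_le_one).add
    (continuous_one_div_sqrt_one_sub_mul hm hm1 (by fun_prop)
      fun θ => sub_le_self 1 (sq_nonneg _))

lemma two_mul_Kell {k : ℝ} (hk1 : k ^ 2 < 1) :
    2 * Kell k = ∫ θ in (0 : ℝ)..(π / 2),
      (1 / √(1 - k ^ 2 * sin θ ^ 2) + 1 / √(1 - k ^ 2 * (1 - sin θ ^ 2))) := by
  have hk := sq_nonneg k
  rw [intervalIntegral.integral_add
    ((continuous_one_div_sqrt_one_sub_mul hk hk1 (by fun_prop)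
      Real.sin_sq_le_one).intervalIntegrable _ _)
    ((continuous_one_div_sqrt_one_sub_mul hk hk1 (by fun_prop)
      fun θ => sub_le_self 1 (sq_nonneg _)).intervalIntegrable _ _)]
  have h := intervalIntegral.integral_comp_sub_left (a := 0) (b := π / 2)
    (fun θ => 1 / √(1 - k ^ 2 * sin θ ^ 2)) (π / 2)
  simp only [sub_self, sub_zero, Real.sin_pi_div_two_sub, Real.cos_sq'] at h
  rw [h, Kell, two_mul]

lemma quartic_root_mul_Kell_mono {k l : ℝ} (hl : 0 ≤ l) (hlk : l ≤ k) (hk1 : k ^ 2 < 1) :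
    √(√(1 - l ^ 2 + (l ^ 2) ^ 2)) * Kell l ≤ √(√(1 - k ^ 2 + (k ^ 2) ^ 2)) * Kell k := by
  have hsq : l ^ 2 ≤ k ^ 2 := pow_le_pow_left₀ hl hlk 2
  have hl1 := hsq.trans_lt hk1
  refine le_of_mul_le_mul_left ?_ (zero_lt_two' ℝ)
  rw [mul_left_comm, mul_left_comm 2, two_mul_Kell hl1, two_mul_Kell hk1,
    ← intervalIntegral.integral_const_mul, ← intervalIntegral.integral_const_mul]
  refine intervalIntegral.integral_mono_on (by positivity)
    ((continuous_const.mul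
      (continuous_symmetrized_integrand (sq_nonneg l) hl1)).intervalIntegrable _ _)
    ((continuous_const.mul
      (continuous_symmetrized_integrand (sq_nonneg k) hk1)).intervalIntegrable _ _) fun θ _ => ?_
  exact symmetrized_integrand_mono hsq (sq_nonneg l) hk1 (sq_nonneg _) (Real.sin_sq_le_one θ)

lemma kfun_sq_lt_one_and_rfun_mul {c η : ℝ} (hc : 0 < c)
    (hη : η ∈ Set.Ioo (2 * c / √3) (2 * c)) :
    kfun η c ^ 2 < 1 ∧
      rfun η c * (1 - kfun η c ^ 2 + (kfun η c ^ 2) ^ 2) = 16 * c ^ 4 := by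
  obtain ⟨h1, h2⟩ := hη
  have hη0 : 0 < η := lt_trans (by positivity) h1
  have hlow : 4 * c ^ 2 < 3 * η ^ 2 := by
    rw [div_lt_iff₀ (by positivity)] at h1
    have := pow_lt_pow_left₀ h1 (by positivity) two_ne_zero
    rw [mul_pow, mul_pow, Real.sq_sqrt (by norm_num)] at this
    linarith
  have hup : η ^ 2 < 4 * c ^ 2 := by
    have := pow_lt_pow_left₀ h2 hη0.le two_ne_zero
    linarith
  have hr : 3 * rfun η c = 64 * c ^ 4 - (3 * η ^ 2 - 8 * c ^ 2) ^ 2 := by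
    rw [rfun]; ring
  have hr16 : (4 * c ^ 2) ^ 2 < rfun η c := by nlinarith
  have hR : 4 * c ^ 2 < √(rfun η c) := Real.lt_sqrt_of_sq_lt hr16
  have hR0 : 0 < √(rfun η c) := lt_trans (by positivity) hR
  have hRR : √(rfun η c) ^ 2 = rfun η c :=
    Real.sq_sqrt ((sq_nonneg _).trans hr16.le)
  have hk : kfun η c ^ 2 =
      (3 * η ^ 2 - 8 * c ^ 2 + √(rfun η c)) / (2 * √(rfun η c)) := by
    rw [kfun, Real.sq_sqrt]
    exact div_nonneg (by linarith) (by positivity)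
  rw [hk]
  refine ⟨by rw [div_lt_one (by positivity)]; linarith, ?_⟩
  rw [← hRR] at hr
  nth_rewrite 1 [← hRR]
  field_simp
  linear_combination hr

lemma Gfun_mul_sqrt {c η : ℝ} (hc : 0 < c) (hη : η ∈ Set.Ioo (2 * c / √3) (2 * c)) :
    Gfun η c * √c =
      4 * (√(√(1 - kfun η c ^ 2 + (kfun η c ^ 2) ^ 2)) * Kell (kfun η c)) := by
  obtain ⟨hk1, hr⟩ := kfun_sq_lt_one_and_rfun_mul hc hη
  have hN : 0 < 1 - kfun η c ^ 2 + (kfun η c ^ 2) ^ 2 :=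
    add_pos_of_pos_of_nonneg (by linarith) (sq_nonneg _)
  have hr0 : 0 < rfun η c := pos_of_mul_pos_left (hr ▸ by positivity) hN.le
  have hroot : √(√(rfun η c)) * √(√(1 - kfun η c ^ 2 + (kfun η c ^ 2) ^ 2)) = 2 * c := by
    rw [← Real.sqrt_mul (Real.sqrt_nonneg _), ← Real.sqrt_mul hr0.le, hr,
      show 16 * c ^ 4 = ((2 * c) ^ 2) ^ 2 by ring, Real.sqrt_sq (by positivity),
      Real.sqrt_sq (by positivity)]
  have hq : 0 < √(√(rfun η c)) := by positivity
  rw [Gfun, rpow_one_div_four_eq_sqrt_sqrt hr0.le, div_mul_eq_mul_div, div_eq_iff hq.ne']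
  linear_combination (8 * Kell (kfun η c)) * Real.mul_self_sqrt hc.le -
    (4 * Kell (kfun η c)) * hroot

/-- Along the family of L-periodic DSW waves, the elliptic modulus κ is a strictly
increasing function of the wave speed c. -/
theorem dsw_modulus_increasing_in_speed
    (L c₁ c₂ η₁ η₂ : ℝ) (hL : 0 < L)
    (hc₁ : 4 * Real.pi ^ 2 / L ^ 2 < c₁) (hc₁₂ : c₁ < c₂)
    (hη₁ : η₁ ∈ Set.Ioo (2 * c₁ / Real.sqrt 3) (2 * c₁))
    (hη₂ : η₂ ∈ Set.Ioo (2 * c₂ / Real.sqrt 3) (2 * c₂))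
    (hG₁ : Gfun η₁ c₁ = L) (hG₂ : Gfun η₂ c₂ = L) :
    kfun η₁ c₁ < kfun η₂ c₂ := by
  have hc₁0 : 0 < c₁ := lt_trans (by positivity) hc₁
  by_contra! hle
  have h := quartic_root_mul_Kell_mono (l := kfun η₂ c₂) (Real.sqrt_nonneg _) hle
    (kfun_sq_lt_one_and_rfun_mul hc₁0 hη₁).1
  have h1 := Gfun_mul_sqrt hc₁0 hη₁
  have h2 := Gfun_mul_sqrt (hc₁0.trans hc₁₂) hη₂
  rw [hG₁] at h1
  rw [hG₂] at h2
  have hlt := mul_lt_mul_of_pos_left (Real.sqrt_lt_sqrt hc₁0.le hc₁₂) hL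
  linarith
end

section
/- Let 0 < κ < 1 and L > 0. Let sn, cn, dn : ℝ → ℝ be differentiable functions satisfying sn' = cn·dn, cn' = −sn·dn, dn' = −κ²·sn·cn with sn(0) = 0, cn(0) = 1, dn(0) = 1 (the Jacobi elliptic functions of modulus κ), and let K > 0 be the first positive zero of cn, i.e. cn(K) = 0 and cn(x) > 0 for 0 ≤ x < K. Define h = 4√(1 − κ² + κ⁴), c = 4K²h/L², η₄ = (8√2 K²/(√3 L²))·√(h(h + 2(2κ² − 1))), β² = 2κ²·√(h + 2(2κ² − 1))/(√(h + 2(2κ² − 1)) + √3·√(h − 2(2κ² − 1))), F₁ = −η₄(4c² − η₄²)/(8c), α = 2K/L, and ψ(ξ) = η₄·dn(αξ)²/(1 + β²·sn(αξ)²). Then ψ is L-periodic and satisfies ψ''(ξ) + ψ(ξ)³/(2c) − cψ(ξ) = F₁ for all ξ ∈ ℝ. -/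
open Real

/-- The vector field whose integral curve is the triple `(sn, cn, dn)` of modulus `κ`. -/
def jacobiField (κ : ℝ) (p : ℝ × ℝ × ℝ) : ℝ × ℝ × ℝ :=
  (p.2.1 * p.2.2, -(p.1 * p.2.2), -(κ ^ 2 * p.1 * p.2.1))

/-- Integral curves of the Jacobi field inside the unit ball are determined by one value. -/
theorem jacobiField_unique {κ t₀ : ℝ} {f g : ℝ → ℝ × ℝ × ℝ}
    (hf : ∀ t, HasDerivAt f (jacobiField κ (f t)) t) (hf1 : ∀ t, ‖f t‖ ≤ 1)
    (hg : ∀ t, HasDerivAt g (jacobiField κ (g t)) t) (hg1 : ∀ t, ‖g t‖ ≤ 1)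
    (heq : f t₀ = g t₀) : f = g := by
  have hsmooth : ContDiff ℝ 1 (jacobiField κ) := by
    unfold jacobiField
    fun_prop
  obtain ⟨C, hC⟩ := hsmooth.contDiffOn.exists_lipschitzOnWith one_ne_zero
    (convex_closedBall (0 : ℝ × ℝ × ℝ) 1) (isCompact_closedBall 0 1)
  exact ODE_solution_unique_univ (v := fun _ ↦ jacobiField κ)
    (s := fun _ ↦ Metric.closedBall 0 1) (fun _ ↦ hC)
    (fun t ↦ ⟨hf t, by simpa using hf1 t⟩) (fun t ↦ ⟨hg t, by simpa using hg1 t⟩) heq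

section JacobiSystem

variable {κ : ℝ} {sn cn dn : ℝ → ℝ}

theorem jacobi_sn_sq_add_cn_sq
    (hsn' : ∀ x : ℝ, HasDerivAt sn (cn x * dn x) x)
    (hcn' : ∀ x : ℝ, HasDerivAt cn (-(sn x * dn x)) x)
    (hsn0 : sn 0 = 0) (hcn0 : cn 0 = 1) (x : ℝ) : sn x ^ 2 + cn x ^ 2 = 1 := by
  have hd : ∀ y, HasDerivAt (fun y ↦ sn y ^ 2 + cn y ^ 2) 0 y := fun y ↦ by
    refine (((hsn' y).fun_pow 2).fun_add ((hcn' y).fun_pow 2)).congr_deriv ?_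
    push_cast
    ring
  have := is_const_of_deriv_eq_zero (fun y ↦ (hd y).differentiableAt) (fun y ↦ (hd y).deriv) x 0
  simpa [hsn0, hcn0] using this

theorem jacobi_dn_sq
    (hsn' : ∀ x : ℝ, HasDerivAt sn (cn x * dn x) x)
    (hdn' : ∀ x : ℝ, HasDerivAt dn (-(κ ^ 2 * sn x * cn x)) x)
    (hsn0 : sn 0 = 0) (hdn0 : dn 0 = 1) (x : ℝ) : dn x ^ 2 = 1 - κ ^ 2 * sn x ^ 2 := by
  have hd : ∀ y, HasDerivAt (fun y ↦ dn y ^ 2 + κ ^ 2 * sn y ^ 2) 0 y := fun y ↦ by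
    refine (((hdn' y).fun_pow 2).fun_add (((hsn' y).fun_pow 2).const_mul (κ ^ 2))).congr_deriv ?_
    push_cast
    ring
  have := is_const_of_deriv_eq_zero (fun y ↦ (hd y).differentiableAt) (fun y ↦ (hd y).deriv) x 0
  simp only [hsn0, hdn0] at this
  linarith

theorem jacobi_sn_add_two_mul_quarter
    (hsn' : ∀ x : ℝ, HasDerivAt sn (cn x * dn x) x)
    (hcn' : ∀ x : ℝ, HasDerivAt cn (-(sn x * dn x)) x)
    (hdn' : ∀ x : ℝ, HasDerivAt dn (-(κ ^ 2 * sn x * cn x)) x)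
    (hsn0 : sn 0 = 0) (hcn0 : cn 0 = 1) (hdn0 : dn 0 = 1)
    {K : ℝ} (hcnK : cn K = 0) (x : ℝ) : sn (x + 2 * K) = -sn x := by
  have hsc := jacobi_sn_sq_add_cn_sq hsn' hcn' hsn0 hcn0
  have hd := jacobi_dn_sq hsn' hdn' hsn0 hdn0
  have hs1 : ∀ y, |sn y| ≤ 1 := fun y ↦ by
    rw [← sq_le_one_iff_abs_le_one]
    nlinarith [hsc y, sq_nonneg (cn y)]
  have hc1 : ∀ y, |cn y| ≤ 1 := fun y ↦ by
    rw [← sq_le_one_iff_abs_le_one]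
    nlinarith [hsc y, sq_nonneg (sn y)]
  have hd1 : ∀ y, |dn y| ≤ 1 := fun y ↦ by
    rw [← sq_le_one_iff_abs_le_one]
    nlinarith [hd y, sq_nonneg (κ * sn y)]
  have hodd : (fun t ↦ (sn t, cn t, dn t)) = fun t ↦ (-sn (-t), cn (-t), dn (-t)) := by
    refine jacobiField_unique (κ := κ) (t₀ := 0)
      (fun t ↦ (hsn' t).prodMk ((hcn' t).prodMk (hdn' t)))
      (fun t ↦ by simp [Prod.norm_def, hs1, hc1, hd1]) (fun t ↦ ?_)
      (fun t ↦ by simp [Prod.norm_def, hs1, hc1, hd1]) (by simp [hsn0])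
    have hneg := hasDerivAt_neg t
    refine ((((hsn' (-t)).comp t hneg).fun_neg).prodMk
      (((hcn' (-t)).comp t hneg).prodMk ((hdn' (-t)).comp t hneg))).congr_deriv ?_
    simp [jacobiField]
  have hrefl : (fun t ↦ (sn (K + t), cn (K + t), dn (K + t))) =
      fun t ↦ (sn (K - t), -cn (K - t), dn (K - t)) := by
    refine jacobiField_unique (κ := κ) (t₀ := 0) (fun t ↦ ?_)
      (fun t ↦ by simp [Prod.norm_def, hs1, hc1, hd1]) (fun t ↦ ?_)
      (fun t ↦ by simp [Prod.norm_def, hs1, hc1, hd1]) (by simp [hcnK])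
    · exact ((hsn' (K + t)).comp_const_add K t).prodMk
        (((hcn' (K + t)).comp_const_add K t).prodMk ((hdn' (K + t)).comp_const_add K t))
    · refine (((hsn' (K - t)).comp_const_sub K t).prodMk
        ((((hcn' (K - t)).comp_const_sub K t).fun_neg).prodMk
          ((hdn' (K - t)).comp_const_sub K t))).congr_deriv ?_
      simp [jacobiField]
  have h1 := congrArg Prod.fst (congrFun hrefl (x + K))
  have h2 := congrArg Prod.fst (congrFun hodd (-x))
  simp only [neg_neg] at h1 h2
  rw [show x + 2 * K = K + (x + K) by ring, h1, show K - (x + K) = -x by ring, h2]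

/-- The second derivative of `η dn² / (1 + b sn²)` at `α ξ`, as a rational function of `sn²`. -/
theorem jacobi_deriv_deriv_profile
    (hsn' : ∀ x : ℝ, HasDerivAt sn (cn x * dn x) x)
    (hcn' : ∀ x : ℝ, HasDerivAt cn (-(sn x * dn x)) x)
    (hdn' : ∀ x : ℝ, HasDerivAt dn (-(κ ^ 2 * sn x * cn x)) x)
    (hsn0 : sn 0 = 0) (hcn0 : cn 0 = 1) (hdn0 : dn 0 = 1)
    {b : ℝ} (hb : 0 ≤ b) (η α ξ : ℝ) :
    deriv (deriv fun y ↦ η * dn (α * y) ^ 2 / (1 + b * sn (α * y) ^ 2)) ξ =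
      η * α ^ 2 * (κ ^ 2 + b) *
        (8 * b * sn (α * ξ) ^ 2 * (1 - sn (α * ξ) ^ 2) * (1 - κ ^ 2 * sn (α * ξ) ^ 2)
          - (2 - 4 * (1 + κ ^ 2) * sn (α * ξ) ^ 2 + 6 * κ ^ 2 * (sn (α * ξ) ^ 2) ^ 2)
            * (1 + b * sn (α * ξ) ^ 2)) / (1 + b * sn (α * ξ) ^ 2) ^ 3 := by
  have hsc := jacobi_sn_sq_add_cn_sq hsn' hcn' hsn0 hcn0
  have hdsq := jacobi_dn_sq hsn' hdn' hsn0 hdn0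
  have hlin : ∀ y, HasDerivAt (fun y ↦ α * y) α y := fun y ↦ by
    simpa using (hasDerivAt_id y).const_mul α
  have hs : ∀ y, HasDerivAt (fun y ↦ sn (α * y)) (cn (α * y) * dn (α * y) * α) y :=
    fun y ↦ (hsn' (α * y)).comp y (hlin y)
  have hc : ∀ y, HasDerivAt (fun y ↦ cn (α * y)) (-(sn (α * y) * dn (α * y)) * α) y :=
    fun y ↦ (hcn' (α * y)).comp y (hlin y)
  have hd : ∀ y, HasDerivAt (fun y ↦ dn (α * y)) (-(κ ^ 2 * sn (α * y) * cn (α * y)) * α) y :=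
    fun y ↦ (hdn' (α * y)).comp y (hlin y)
  have hD : ∀ y, 1 + b * sn (α * y) ^ 2 ≠ 0 := fun y ↦ by positivity
  have hden : ∀ y, HasDerivAt (fun y ↦ 1 + b * sn (α * y) ^ 2)
      (2 * b * sn (α * y) * cn (α * y) * dn (α * y) * α) y := fun y ↦ by
    refine ((((hs y).fun_pow 2).const_mul b).const_add 1).congr_deriv ?_
    push_cast
    ring
  have hfirst : (deriv fun y ↦ η * dn (α * y) ^ 2 / (1 + b * sn (α * y) ^ 2)) = fun y ↦
      -(2 * η * α * (κ ^ 2 + b)) * (sn (α * y) * cn (α * y) * dn (α * y))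
        / (1 + b * sn (α * y) ^ 2) ^ 2 := by
    funext y
    rw [((((hd y).fun_pow 2).const_mul η).fun_div (hden y) (hD y)).deriv]
    congr 1
    push_cast
    linear_combination -2 * η * α * b * sn (α * y) * cn (α * y) * dn (α * y) * hdsq (α * y)
  rw [hfirst, (((((hs ξ).fun_mul (hc ξ)).fun_mul (hd ξ)).const_mul _).fun_div ((hden ξ).fun_pow 2)
    (pow_ne_zero 2 (hD ξ))).deriv]
  have hDξ := hD ξ
  have e1 : cn (α * ξ) ^ 2 = 1 - sn (α * ξ) ^ 2 := by linarith [hsc (α * ξ)]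
  have e2 := hdsq (α * ξ)
  have e3 : cn (α * ξ) ^ 2 * dn (α * ξ) ^ 2 =
      (1 - sn (α * ξ) ^ 2) * (1 - κ ^ 2 * sn (α * ξ) ^ 2) := by rw [e1, e2]
  push_cast
  generalize sn (α * ξ) = s at *
  generalize cn (α * ξ) = k at *
  generalize dn (α * ξ) = d at *
  rw [div_eq_div_iff (by positivity) (by positivity)]
  linear_combination (1 + b * s ^ 2) ^ 4 * (η * α ^ 2 * (κ ^ 2 + b)) *
    (-2 * (1 + b * s ^ 2) * (e3 - s ^ 2 * e2 - κ ^ 2 * s ^ 2 * e1) + 8 * b * s ^ 2 * e3)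

end JacobiSystem

theorem profile_coefficient_eq {m h b : ℝ} (hm0 : 0 < m) (hm1 : m < 1)
    (hh : h = 4 * √(1 - m + m ^ 2))
    (hb : b = 2 * m * √(h + 2 * (2 * m - 1))
      / (√(h + 2 * (2 * m - 1)) + √3 * √(h - 2 * (2 * m - 1)))) :
    0 < b ∧ h = 4 * (b + 1 - m) ∧ b ^ 2 + 2 * b = 2 * m * b + m := by
  have hrt : √(1 - m + m ^ 2) ^ 2 = 1 - m + m ^ 2 := Real.sq_sqrt (by nlinarith)
  have hlt : 1 - m < √(1 - m + m ^ 2) := Real.lt_sqrt_of_sq_lt (by nlinarith)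
  obtain ⟨B, hB⟩ : ∃ B, B = √(1 - m + m ^ 2) - (1 - m) := ⟨_, rfl⟩
  have hB0 : 0 < B := by linarith
  have hhB : h = 4 * (B + 1 - m) := by rw [hh, hB]; ring
  have hrel : B ^ 2 + 2 * B = 2 * m * B + m := by
    rw [hB]
    linear_combination hrt
  have hp : h + 2 * (2 * m - 1) = 4 * B + 2 := by rw [hhB]; ring
  have hq : h - 2 * (2 * m - 1) = 4 * B + 6 - 8 * m := by rw [hhB]; ring
  have hpq : (4 * B + 2) * (3 * (4 * B + 6 - 8 * m)) = 6 ^ 2 := by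
    linear_combination 48 * hrel
  have hP : 0 < √(4 * B + 2) := Real.sqrt_pos.2 (by linarith)
  have hP2 : √(4 * B + 2) ^ 2 = 4 * B + 2 := Real.sq_sqrt (by linarith)
  have hPS : √(4 * B + 2) * (√3 * √(4 * B + 6 - 8 * m)) = 6 := by
    rw [← Real.sqrt_mul (by norm_num), ← Real.sqrt_mul (by linarith), hpq]
    exact Real.sqrt_sq (by norm_num)
  have hbB : b = B := by
    rw [hb, hp, hq, div_eq_iff (by positivity)]
    apply mul_left_cancel₀ hP.ne'
    linear_combination (2 * m - B) * hP2 - B * hPS - 4 * hrel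
  rw [hbB]
  exact ⟨hB0, hhB, hrel⟩

/-- The polynomial identity in `u = sn²` behind the profile equation. -/
theorem profile_polynomial_identity {b m : ℝ} (u : ℝ) (hb : b ^ 2 + 2 * b = 2 * m * b + m) :
    (m + b) * (8 * b * u * (1 - u) * (1 - m * u)
        - (2 - 4 * (1 + m) * u + 6 * m * u ^ 2) * (1 + b * u))
      + 4 / 3 * (4 * b + 2) * (1 - m * u) ^ 3
      - 4 * (b + 1 - m) * (1 - m * u) * (1 + b * u) ^ 2
      + (2 * (b + 1 - m) - (4 * b + 2) / 3) * (1 + b * u) ^ 3 = 0 := by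
  grind

/-- The explicit formula ψ(ξ) = η₄ dn²(αξ)/(1 + β² sn²(αξ)), with the parameters
h, c, η₄, β², F₁, α expressed via the elliptic modulus κ and the period L, gives an
L-periodic solution of the traveling-wave profile equation ψ'' + ψ³/(2c) − cψ = F₁. -/
theorem dsw_explicit_periodic_profile
    (κ L : ℝ) (hκ0 : 0 < κ) (hκ1 : κ < 1) (hL : 0 < L)
    (sn cn dn : ℝ → ℝ)
    (hsn' : ∀ x : ℝ, HasDerivAt sn (cn x * dn x) x)
    (hcn' : ∀ x : ℝ, HasDerivAt cn (-(sn x * dn x)) x)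
    (hdn' : ∀ x : ℝ, HasDerivAt dn (-(κ ^ 2 * sn x * cn x)) x)
    (hsn0 : sn 0 = 0) (hcn0 : cn 0 = 1) (hdn0 : dn 0 = 1)
    (K : ℝ) (hK : 0 < K) (hcnK : cn K = 0)
    (hcnpos : ∀ x : ℝ, 0 ≤ x → x < K → 0 < cn x)
    (h c η₄ βsq F₁ α : ℝ)
    (hh : h = 4 * Real.sqrt (1 - κ ^ 2 + κ ^ 4))
    (hc : c = 4 * K ^ 2 * h / L ^ 2)
    (hη₄ : η₄ = (8 * Real.sqrt 2 * K ^ 2 / (Real.sqrt 3 * L ^ 2))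
        * Real.sqrt (h * (h + 2 * (2 * κ ^ 2 - 1))))
    (hβsq : βsq = 2 * κ ^ 2 * Real.sqrt (h + 2 * (2 * κ ^ 2 - 1))
        / (Real.sqrt (h + 2 * (2 * κ ^ 2 - 1))
            + Real.sqrt 3 * Real.sqrt (h - 2 * (2 * κ ^ 2 - 1))))
    (hF₁ : F₁ = -η₄ * (4 * c ^ 2 - η₄ ^ 2) / (8 * c))
    (hα : α = 2 * K / L)
    (ψ : ℝ → ℝ)
    (hψ : ∀ ξ : ℝ, ψ ξ = η₄ * dn (α * ξ) ^ 2 / (1 + βsq * sn (α * ξ) ^ 2)) :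
    (∀ ξ : ℝ, ψ (ξ + L) = ψ ξ) ∧
    (∀ ξ : ℝ, deriv (deriv ψ) ξ + ψ ξ ^ 3 / (2 * c) - c * ψ ξ = F₁) := by
  have hm0 : 0 < κ ^ 2 := by positivity
  have hm1 : κ ^ 2 < 1 := by nlinarith
  obtain ⟨hb0, hhb, hrel⟩ := profile_coefficient_eq hm0 hm1
    (by rw [hh]; ring_nf) hβsq
  have hhpos : 0 < h := by linarith
  have hα0 : 0 < α := by rw [hα]; positivity
  have hcα : c = α ^ 2 * h := by rw [hc, hα]; field_simp; ring
  have hη2 : η₄ ^ 2 = 8 / 3 * (α ^ 2) ^ 2 * h * (4 * βsq + 2) := by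
    have hp : h + 2 * (2 * κ ^ 2 - 1) = 4 * βsq + 2 := by rw [hhb]; ring
    rw [hη₄, hp, mul_pow, Real.sq_sqrt (by positivity), div_pow, mul_pow, mul_pow, mul_pow,
      Real.sq_sqrt (by norm_num), Real.sq_sqrt (by norm_num), hα]
    field_simp
    ring
  have hdsq := jacobi_dn_sq hsn' hdn' hsn0 hdn0
  refine ⟨fun ξ ↦ ?_, fun ξ ↦ ?_⟩
  · have harg : α * (ξ + L) = α * ξ + 2 * K := by rw [hα]; field_simp
    have hs := jacobi_sn_add_two_mul_quarter hsn' hcn' hdn' hsn0 hcn0 hdn0 hcnK (α * ξ)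
    rw [hψ, hψ, hdsq, hdsq, harg, hs, neg_sq]
  · rw [funext hψ, jacobi_deriv_deriv_profile hsn' hcn' hdn' hsn0 hcn0 hdn0 hb0.le, hF₁]
    beta_reduce
    rw [hdsq]
    have hD : 0 < 1 + βsq * sn (α * ξ) ^ 2 := by positivity
    have hpoly := profile_polynomial_identity (sn (α * ξ) ^ 2) hrel
    generalize sn (α * ξ) ^ 2 = u at *
    have hcube : (η₄ * (1 - κ ^ 2 * u) / (1 + βsq * u)) ^ 3 / (2 * c) =
        η₄ * α ^ 2 * (4 / 3 * (4 * βsq + 2)) * (1 - κ ^ 2 * u) ^ 3 / (1 + βsq * u) ^ 3 := by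
      have : η₄ ^ 3 = η₄ * (8 / 3 * (α ^ 2) ^ 2 * h * (4 * βsq + 2)) := by rw [← hη2]; ring
      rw [div_pow, mul_pow, this, hcα]
      field_simp
      ring
    have hconst : -η₄ * (4 * c ^ 2 - η₄ ^ 2) / (8 * c) =
        -(η₄ * α ^ 2 * (h / 2 - (4 * βsq + 2) / 3)) := by
      rw [hη2, hcα]
      field_simp
      ring
    rw [hcube, hconst, hcα, hhb]
    field_simp
    linear_combination 6 * η₄ * hpoly
end

section
/- For all τ₁, τ₂ ∈ ℝ and k₁, k₂ ∈ ℤ with k₂ ≠ 0, setting τ = τ₁ + τ₂ and k = k₁ + k₂, one has the resonance identity τ − k³ = (τ₁ − k₁³) + τ₂ − k₂(k₁² + k² + k₁k), and consequently max(|τ − k³|, |τ₁ − k₁³|, |τ₂|) ≥ (1/4)·|k₂|·max(k₁², k²). -/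
/-- The quadratic form `x² + y² + xy` controls three quarters of the larger square. -/
theorem three_quarters_mul_max_sq_le (x y : ℝ) :
    3 / 4 * max (x ^ 2) (y ^ 2) ≤ x ^ 2 + y ^ 2 + x * y := by
  rcases max_cases (x ^ 2) (y ^ 2) with ⟨h, -⟩ | ⟨h, -⟩ <;> rw [h]
  · nlinarith [sq_nonneg (x + 2 * y)]
  · nlinarith [sq_nonneg (2 * x + y)]

/-- If `a = b + c - z (x² + y² + xy)`, then one of `a`, `b`, `c` is at least a third of the
resonance `z (x² + y² + xy)` in absolute value. -/
theorem quarter_mul_max_sq_le_max_abs {a b c x y z : ℝ}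
    (h : a = b + c - z * (x ^ 2 + y ^ 2 + x * y)) :
    1 / 4 * |z| * max (x ^ 2) (y ^ 2) ≤ max |a| (max |b| |c|) := by
  have hq := three_quarters_mul_max_sq_le x y
  have hq_nonneg : 0 ≤ x ^ 2 + y ^ 2 + x * y :=
    le_trans (by positivity) hq
  have hz : |z| * (x ^ 2 + y ^ 2 + x * y) = |b + c - a| := by
    have hres : z * (x ^ 2 + y ^ 2 + x * y) = b + c - a := by linarith
    rw [← hres, abs_mul, abs_of_nonneg hq_nonneg]
  have htri : |b + c - a| ≤ |b| + |c| + |a| :=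
    (abs_sub _ _).trans (by gcongr; exact abs_add_le b c)
  have ha : |a| ≤ max |a| (max |b| |c|) := le_max_left _ _
  have hb : |b| ≤ max |a| (max |b| |c|) := (le_max_left _ _).trans (le_max_right _ _)
  have hc : |c| ≤ max |a| (max |b| |c|) := (le_max_right _ _).trans (le_max_right _ _)
  linarith [mul_le_mul_of_nonneg_left hq (abs_nonneg z)]


/-- The resonance identity and modulation lower bound for the bilinear term u·v of the
DSW system: with τ = τ₁ + τ₂, k = k₁ + k₂, k₂ ≠ 0,
τ − k³ = (τ₁ − k₁³) + τ₂ − k₂(k₁² + k² + k₁k) and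
max(|τ − k³|, |τ₁ − k₁³|, |τ₂|) ≥ (1/4)|k₂| max(k₁², k²). -/
theorem dsw_bilinear_modulation_bound
    (τ₁ τ₂ : ℝ) (k₁ k₂ : ℤ) (hk₂ : k₂ ≠ 0) :
    ((τ₁ + τ₂) - ((k₁ + k₂ : ℤ) : ℝ) ^ 3
      = (τ₁ - (k₁ : ℝ) ^ 3) + τ₂
        - (k₂ : ℝ) * ((k₁ : ℝ) ^ 2 + ((k₁ + k₂ : ℤ) : ℝ) ^ 2
            + (k₁ : ℝ) * ((k₁ + k₂ : ℤ) : ℝ))) ∧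
    max (|(τ₁ + τ₂) - ((k₁ + k₂ : ℤ) : ℝ) ^ 3|)
        (max (|τ₁ - (k₁ : ℝ) ^ 3|) (|τ₂|))
      ≥ (1 / 4) * |(k₂ : ℝ)| * max ((k₁ : ℝ) ^ 2) (((k₁ + k₂ : ℤ) : ℝ) ^ 2) := by
  have resonance : (τ₁ + τ₂) - ((k₁ + k₂ : ℤ) : ℝ) ^ 3
      = (τ₁ - (k₁ : ℝ) ^ 3) + τ₂
        - (k₂ : ℝ) * ((k₁ : ℝ) ^ 2 + ((k₁ + k₂ : ℤ) : ℝ) ^ 2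
            + (k₁ : ℝ) * ((k₁ + k₂ : ℤ) : ℝ)) := by
    push_cast
    ring
  refine ⟨resonance, ?_⟩
  exact quarter_mul_max_sq_le_max_abs resonance
end

section
/- For all τ₁, τ₂ ∈ ℝ and k₁, k₂ ∈ ℤ with k₁ + k₂ ≠ 0, setting τ = τ₁ + τ₂ and k = k₁ + k₂, one has the identity τ = (τ₁ − k₁³) + (τ₂ − k₂³) + k(k₁² + k₂² − k₁k₂), and consequently max(|τ|, |τ₁ − k₁³|, |τ₂ − k₂³|) ≥ (1/6)·|k|·max(k₁², k₂²). -/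
theorem half_max_sq_le_sq_add_sq_sub_mul (a b : ℝ) :
    1 / 2 * max (a ^ 2) (b ^ 2) ≤ a ^ 2 + b ^ 2 - a * b := by
  rcases max_cases (a ^ 2) (b ^ 2) with ⟨h, -⟩ | ⟨h, -⟩ <;> rw [h] <;>
    nlinarith [sq_nonneg (a - b)]


/-- The resonance identity and modulation lower bound for the quadratic term u·u in the
v-equation of the DSW system: with τ = τ₁ + τ₂, k = k₁ + k₂ ≠ 0,
τ = (τ₁ − k₁³) + (τ₂ − k₂³) + k(k₁² + k₂² − k₁k₂) and
max(|τ|, |τ₁ − k₁³|, |τ₂ − k₂³|) ≥ (1/6)|k| max(k₁², k₂²). -/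
theorem dsw_quadratic_modulation_bound
    (τ₁ τ₂ : ℝ) (k₁ k₂ : ℤ) (hk : k₁ + k₂ ≠ 0) :
    (τ₁ + τ₂
      = (τ₁ - (k₁ : ℝ) ^ 3) + (τ₂ - (k₂ : ℝ) ^ 3)
        + ((k₁ + k₂ : ℤ) : ℝ) * ((k₁ : ℝ) ^ 2 + (k₂ : ℝ) ^ 2 - (k₁ : ℝ) * (k₂ : ℝ))) ∧
    max (|τ₁ + τ₂|) (max (|τ₁ - (k₁ : ℝ) ^ 3|) (|τ₂ - (k₂ : ℝ) ^ 3|))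
      ≥ (1 / 6) * |((k₁ + k₂ : ℤ) : ℝ)| * max ((k₁ : ℝ) ^ 2) ((k₂ : ℝ) ^ 2) := by
  have resonance : τ₁ + τ₂
      = (τ₁ - (k₁ : ℝ) ^ 3) + (τ₂ - (k₂ : ℝ) ^ 3)
        + ((k₁ + k₂ : ℤ) : ℝ) * ((k₁ : ℝ) ^ 2 + (k₂ : ℝ) ^ 2 - (k₁ : ℝ) * (k₂ : ℝ)) := by
    push_cast
    ring
  refine ⟨resonance, ?_⟩
  set M := max |τ₁ + τ₂| (max |τ₁ - (k₁ : ℝ) ^ 3| |τ₂ - (k₂ : ℝ) ^ 3|)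
  have h : |τ₁ + τ₂| ≤ M := le_max_left _ _
  have h₁ : |τ₁ - (k₁ : ℝ) ^ 3| ≤ M := (le_max_left _ _).trans (le_max_right _ _)
  have h₂ : |τ₂ - (k₂ : ℝ) ^ 3| ≤ M := (le_max_right _ _).trans (le_max_right _ _)
  have form_ge := half_max_sq_le_sq_add_sq_sub_mul (k₁ : ℝ) k₂
  set Q := (k₁ : ℝ) ^ 2 + (k₂ : ℝ) ^ 2 - (k₁ : ℝ) * (k₂ : ℝ)
  have form_nonneg : 0 ≤ Q := le_trans (by positivity) form_ge
  have upper : |((k₁ + k₂ : ℤ) : ℝ)| * Q ≤ 3 * M := by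
    rw [← abs_of_nonneg form_nonneg, ← abs_mul]
    rw [abs_le] at h h₁ h₂ ⊢
    constructor <;> linarith
  have lower := mul_le_mul_of_nonneg_left form_ge (abs_nonneg ((k₁ + k₂ : ℤ) : ℝ))
  linarith
end

section
/- Let c > 0, let ψ : ℝ → ℝ be a function with φ = ψ²/(2c), and suppose h₁, h₂, h₃ : ℝ → ℝ are twice differentiable and satisfy pointwise L₊h₁ = 1, L₊h₂ = ψ, and L₊h₃ = ψ³. Define the pairs e₁ = (h₁, ψh₁/c), e₂ = (h₂/c, 1/c + ψh₂/c²), and e₃ = (h₃/(2c²) + h₂, ψh₃/(2c³) + ψh₂/c + ψ²/(2c²)). Then, pointwise, H e₁ = (1, 0), H e₂ = (0, 1), and H e₃ = (ψ, φ); that is, writing eⱼ = (fⱼ, gⱼ), one has L₋f₁ − ψg₁ = 1 and −ψf₁ + cg₁ = 0, L₋f₂ − ψg₂ = 0 and −ψf₂ + cg₂ = 1, and L₋f₃ − ψg₃ = ψ and −ψf₃ + cg₃ = φ. -/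
open Real

/-- The first-generation generalized kernel elements of ∂ₓH: if L₊h₁ = 1, L₊h₂ = ψ,
L₊h₃ = ψ³ (with L₊f = −f'' + cf − (3/(2c))ψ²f), then the pairs
e₁ = (h₁, ψh₁/c), e₂ = (h₂/c, 1/c + ψh₂/c²),
e₃ = (h₃/(2c²) + h₂, ψh₃/(2c³) + ψh₂/c + ψ²/(2c²))
satisfy H e₁ = (1,0), H e₂ = (0,1), H e₃ = (ψ, φ), where
H(f,g) = (L₋f − ψg, −ψf + cg), L₋f = −f'' + cf − (ψ²/(2c))f and φ = ψ²/(2c). -/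
theorem dsw_generalized_kernel_elements
    (c : ℝ) (hc : 0 < c) (ψ : ℝ → ℝ)
    (h₁ h₂ h₃ : ℝ → ℝ)
    (hd₁ : ∀ x : ℝ, DifferentiableAt ℝ h₁ x)
    (hd₁' : ∀ x : ℝ, DifferentiableAt ℝ (deriv h₁) x)
    (hd₂ : ∀ x : ℝ, DifferentiableAt ℝ h₂ x)
    (hd₂' : ∀ x : ℝ, DifferentiableAt ℝ (deriv h₂) x)
    (hd₃ : ∀ x : ℝ, DifferentiableAt ℝ h₃ x)
    (hd₃' : ∀ x : ℝ, DifferentiableAt ℝ (deriv h₃) x)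
    (hL₁ : ∀ x : ℝ, -(deriv (deriv h₁) x) + c * h₁ x
        - (3 / (2 * c)) * ψ x ^ 2 * h₁ x = 1)
    (hL₂ : ∀ x : ℝ, -(deriv (deriv h₂) x) + c * h₂ x
        - (3 / (2 * c)) * ψ x ^ 2 * h₂ x = ψ x)
    (hL₃ : ∀ x : ℝ, -(deriv (deriv h₃) x) + c * h₃ x
        - (3 / (2 * c)) * ψ x ^ 2 * h₃ x = ψ x ^ 3) :
    -- H e₁ = (1, 0) with e₁ = (h₁, ψh₁/c)
    ((∀ x : ℝ, -(deriv (deriv h₁) x) + c * h₁ x - (ψ x ^ 2 / (2 * c)) * h₁ x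
        - ψ x * (ψ x * h₁ x / c) = 1)
      ∧ (∀ x : ℝ, -(ψ x) * h₁ x + c * (ψ x * h₁ x / c) = 0))
    ∧
    -- H e₂ = (0, 1) with e₂ = (h₂/c, 1/c + ψh₂/c²)
    ((∀ x : ℝ, -(deriv (deriv (fun y => h₂ y / c)) x) + c * (h₂ x / c)
        - (ψ x ^ 2 / (2 * c)) * (h₂ x / c)
        - ψ x * (1 / c + ψ x * h₂ x / c ^ 2) = 0)
      ∧ (∀ x : ℝ, -(ψ x) * (h₂ x / c) + c * (1 / c + ψ x * h₂ x / c ^ 2) = 1))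
    ∧
    -- H e₃ = (ψ, φ) with e₃ = (h₃/(2c²) + h₂, ψh₃/(2c³) + ψh₂/c + ψ²/(2c²))
    ((∀ x : ℝ, -(deriv (deriv (fun y => h₃ y / (2 * c ^ 2) + h₂ y)) x)
        + c * (h₃ x / (2 * c ^ 2) + h₂ x)
        - (ψ x ^ 2 / (2 * c)) * (h₃ x / (2 * c ^ 2) + h₂ x)
        - ψ x * (ψ x * h₃ x / (2 * c ^ 3) + ψ x * h₂ x / c + ψ x ^ 2 / (2 * c ^ 2))
        = ψ x)
      ∧ (∀ x : ℝ, -(ψ x) * (h₃ x / (2 * c ^ 2) + h₂ x)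
        + c * (ψ x * h₃ x / (2 * c ^ 3) + ψ x * h₂ x / c + ψ x ^ 2 / (2 * c ^ 2))
        = ψ x ^ 2 / (2 * c))) := by
  have hc₀ : c ≠ 0 := hc.ne'
  have hdd₂ : ∀ x, deriv (deriv (fun y => h₂ y / c)) x = deriv (deriv h₂) x / c := by
    intro x
    have hderiv : deriv (fun y => h₂ y / c) = fun y => deriv h₂ y / c :=
      funext fun y => ((hd₂ y).hasDerivAt.div_const c).deriv
    rw [hderiv]
    exact ((hd₂' x).hasDerivAt.div_const c).deriv
  have hdd₃ : ∀ x, deriv (deriv (fun y => h₃ y / (2 * c ^ 2) + h₂ y)) x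
      = deriv (deriv h₃) x / (2 * c ^ 2) + deriv (deriv h₂) x := by
    intro x
    have hderiv : deriv (fun y => h₃ y / (2 * c ^ 2) + h₂ y)
        = fun y => deriv h₃ y / (2 * c ^ 2) + deriv h₂ y :=
      funext fun y => (((hd₃ y).hasDerivAt.div_const _).add (hd₂ y).hasDerivAt).deriv
    rw [hderiv]
    exact (((hd₃' x).hasDerivAt.div_const _).add (hd₂' x).hasDerivAt).deriv
  refine ⟨⟨fun x => ?_, fun x => ?_⟩, ⟨fun x => ?_, fun x => ?_⟩, ⟨fun x => ?_, fun x => ?_⟩⟩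
  · linear_combination hL₁ x
  · field_simp
    ring
  · rw [hdd₂]
    linear_combination (1 / c) * hL₂ x
  · field_simp
    ring
  · rw [hdd₃]
    linear_combination (1 / (2 * c ^ 2)) * hL₃ x + hL₂ x
  · field_simp
    ring
end
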